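/- arXiv:1802.06291 — 6 statements merged into one kernel-verified Lean document; each statement's English description precedes it below -/
import Mathlib

section
/- Let d ≥ 1, let H be a max-infinitely divisible df with unit Fréchet marginals, let υ be an exponent measure of H, and for each n ∈ ℕ let ν_n be the Borel probability measure whose df is H^{1/n}. Let Q be a continuous df of a Borel probability measure on [0,∞)^d with unit Fréchet marginals. Then lim_{n→∞} n ∫_{ℝ^d} Q(x₁,…,x_d) dν_n(x) = ∫_{(0,∞)^d} Q(x₁,…,x_d) dυ(x) (this limit is denoted λ(Q,H)). -/
open MeasureTheory Filter Topology ProbabilityTheory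
open scoped ENNReal

/-- The unit Fréchet distribution function `Φ(x) = exp(-1/x)` for `x > 0`, `0` otherwise. -/
noncomputable def frechet (x : ℝ) : ℝ := if 0 < x then Real.exp (-(1/x)) else 0

/-- The distribution function of a Borel measure on `ℝ^d`. -/
noncomputable def df {d : ℕ} (ρ : Measure (Fin d → ℝ)) (x : Fin d → ℝ) : ℝ :=
  (ρ {y | ∀ i, y i ≤ x i}).toReal

/-- The `i`-th marginal distribution function of a Borel measure on `ℝ^d`. -/
noncomputable def marg {d : ℕ} (ρ : Measure (Fin d → ℝ)) (i : Fin d) (t : ℝ) : ℝ :=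
  (ρ {y | y i ≤ t}).toReal

/-- All one-dimensional marginal dfs equal the unit Fréchet df. -/
def HasFrechetMarginals {d : ℕ} (ρ : Measure (Fin d → ℝ)) : Prop :=
  ∀ (i : Fin d) (t : ℝ), marg ρ i t = frechet t

/-- The measure is concentrated on `[0,∞)^d`. -/
def SupportedOnNonneg {d : ℕ} (ρ : Measure (Fin d → ℝ)) : Prop :=
  ρ {y | ∃ i, y i < 0} = 0

/-- Max-infinite divisibility: for every `t > 0`, `H^t` is again a df of a Borel
probability measure. -/
def MaxID {d : ℕ} (ρ : Measure (Fin d → ℝ)) : Prop :=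
  ∀ t : ℝ, 0 < t → ∃ ν : Measure (Fin d → ℝ), IsProbabilityMeasure ν ∧
    ∀ x, df ν x = (df ρ x) ^ t

/-- Max-stability (for a df with unit Fréchet marginals):
`H(t x₁, …, t x_d) = H(x₁, …, x_d)^(1/t)` for all `t > 0` and `x ∈ (0,∞)^d`. -/
def MaxStable {d : ℕ} (ρ : Measure (Fin d → ℝ)) : Prop :=
  ∀ t : ℝ, 0 < t → ∀ x : Fin d → ℝ, (∀ i, 0 < x i) →
    df ρ (fun i => t * x i) = (df ρ x) ^ (1/t)

/-- `υ` is an exponent measure of the max-id df of `ρ`: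
`υ{y : y_i > x_i for some i} = -ln H(x)` for all `x ∈ (0,∞)^d`. -/
def IsExponentMeasure {d : ℕ} (ρ υ : Measure (Fin d → ℝ)) : Prop :=
  ∀ x : Fin d → ℝ, (∀ i, 0 < x i) →
    (υ {y | ∃ i, x i < y i}).toReal = - Real.log (df ρ x)

/-- The positive orthant `(0,∞)^d`. -/
def posOrthant (d : ℕ) : Set (Fin d → ℝ) := {x | ∀ i, 0 < x i}

/-- `F` is in the max-domain of attraction of `H` with norming constants `a_n = n`:
`F(n x)^n → H(x)` for every `x ∈ (0,∞)^d`. -/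
def MDA {d : ℕ} (ρ ρH : Measure (Fin d → ℝ)) : Prop :=
  ∀ x : Fin d → ℝ, (∀ i, 0 < x i) →
    Tendsto (fun n : ℕ => (df ρ (fun i => (n : ℝ) * x i)) ^ n) atTop (𝓝 (df ρH x))

/-- The measure of the lower orthant in the coordinates of `K` is the limit of dfs. -/
lemma tendsto_df_ite {d : ℕ} (μ : Measure (Fin d → ℝ)) [IsFiniteMeasure μ]
    (K : Finset (Fin d)) (z : Fin d → ℝ) :
    Tendsto (fun m : ℕ => df μ (fun i => if i ∈ K then z i else (m : ℝ) + 1)) atTop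
      (𝓝 (μ.real {y | ∀ i ∈ K, y i ≤ z i})) := by
  have hU : (⋃ m : ℕ, {y : Fin d → ℝ | ∀ i, y i ≤ if i ∈ K then z i else (m : ℝ) + 1})
      = {y | ∀ i ∈ K, y i ≤ z i} := by
    ext y
    simp only [Set.mem_iUnion, Set.mem_ofPred_eq]
    constructor
    · rintro ⟨m, hm⟩ i hi
      simpa [hi] using hm i
    · intro h
      obtain ⟨M, hM⟩ := (Set.finite_range y).bddAbove
      obtain ⟨m, hm⟩ := exists_nat_ge M
      refine ⟨m, fun i => ?_⟩
      split_ifs with hi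
      · exact h i hi
      · linarith [hM ⟨i, rfl⟩]
  have hmono : Monotone
      (fun m : ℕ => {y : Fin d → ℝ | ∀ i, y i ≤ if i ∈ K then z i else (m : ℝ) + 1}) := by
    intro a b hab y hy i
    refine (hy i).trans ?_
    split_ifs
    · exact le_rfl
    · gcongr
  have h := tendsto_measure_iUnion_atTop (μ := μ) hmono
  rw [hU] at h
  exact (ENNReal.tendsto_toReal (measure_ne_top _ _)).comp h

lemma tendsto_measureReal_exists_lt_ite {d : ℕ} (υ : Measure (Fin d → ℝ))
    (hfin : ∀ x : Fin d → ℝ, (∀ i, 0 < x i) → υ {y | ∃ i, x i < y i} ≠ ∞)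
    (K : Finset (Fin d)) (z : Fin d → ℝ) (hz : ∀ i, 0 < z i) :
    Tendsto (fun m : ℕ => υ.real {y | ∃ i, (if i ∈ K then z i else (m : ℝ) + 1) < y i}) atTop
      (𝓝 (υ.real {y | ∃ i ∈ K, z i < y i})) := by
  have hpos : ∀ (m : ℕ) i, 0 < if i ∈ K then z i else (m : ℝ) + 1 := by
    intro m i
    split_ifs
    · exact hz i
    · positivity
  have hI : (⋂ m : ℕ, {y : Fin d → ℝ | ∃ i, (if i ∈ K then z i else (m : ℝ) + 1) < y i})
      = {y | ∃ i ∈ K, z i < y i} := by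
    ext y
    simp only [Set.mem_iInter, Set.mem_ofPred_eq]
    constructor
    · intro h
      obtain ⟨M, hM⟩ := (Set.finite_range y).bddAbove
      obtain ⟨m, hm⟩ := exists_nat_ge M
      obtain ⟨i, hi⟩ := h m
      split_ifs at hi with hK
      · exact ⟨i, hK, hi⟩
      · linarith [hM ⟨i, rfl⟩]
    · rintro ⟨i, hK, hi⟩ m
      exact ⟨i, by simpa [hK] using hi⟩
  have hanti : Antitone
      (fun m : ℕ => {y : Fin d → ℝ | ∃ i, (if i ∈ K then z i else (m : ℝ) + 1) < y i}) := by
    rintro a b hab y ⟨i, hi⟩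
    refine ⟨i, lt_of_le_of_lt ?_ hi⟩
    split_ifs
    · exact le_rfl
    · gcongr
  have hfinite := hfin _ (hpos 0)
  have h := tendsto_measure_iInter_atTop (μ := υ)
    (fun m : ℕ => (by measurability : MeasurableSet
      {y : Fin d → ℝ | ∃ i, (if i ∈ K then z i else (m : ℝ) + 1) < y i}).nullMeasurableSet)
    hanti ⟨0, hfinite⟩
  rw [hI] at h
  refine (ENNReal.tendsto_toReal ?_).comp h
  refine ne_top_of_le_ne_top (hfin z hz) (measure_mono ?_)
  rintro y ⟨i, -, hi⟩
  exact ⟨i, hi⟩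

/-- Convergence of scaled measures on finite unions of a family passes to finite nonempty
intersections, here joined with a further finite union. -/
lemma tendsto_measureReal_biInter_union_biUnion {α ι : Type*} [MeasurableSpace α]
    (μ : ℕ → Measure α) (υ : Measure α) (A : ι → Set α) (hA : ∀ i, MeasurableSet (A i))
    (hμ : ∀ᶠ n in atTop, ∀ i, μ n (A i) ≠ ∞) (hυ : ∀ i, υ (A i) ≠ ∞)
    (h : ∀ K : Finset ι, Tendsto (fun n : ℕ => (n : ℝ) * (μ n).real (⋃ i ∈ K, A i)) atTop
      (𝓝 (υ.real (⋃ i ∈ K, A i))))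
    (J : Finset ι) (hJ : J.Nonempty) (K : Finset ι) :
    Tendsto (fun n : ℕ => (n : ℝ) * (μ n).real ((⋂ i ∈ J, A i) ∪ ⋃ i ∈ K, A i)) atTop
      (𝓝 (υ.real ((⋂ i ∈ J, A i) ∪ ⋃ i ∈ K, A i))) := by
  classical
  induction hJ using Finset.Nonempty.cons_induction generalizing K with
  | singleton a =>
    have := h (insert a K)
    simpa [Finset.set_biUnion_insert] using this
  | cons a J ha hJ ih =>
    have key : ∀ m : Measure α, (∀ i, m (A i) ≠ ∞) →
        m.real ((⋂ i ∈ Finset.cons a J ha, A i) ∪ ⋃ i ∈ K, A i)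
        = m.real (⋃ i ∈ insert a K, A i) + m.real ((⋂ i ∈ J, A i) ∪ ⋃ i ∈ K, A i)
          - m.real ((⋂ i ∈ J, A i) ∪ ⋃ i ∈ insert a K, A i) := by
      intro m hm
      have hK : ∀ L : Finset ι, m (⋃ i ∈ L, A i) ≠ ∞ := fun L =>
        (measure_biUnion_lt_top L.finite_toSet fun i _ => (hm i).lt_top).ne
      have hJm : m (⋂ i ∈ J, A i) ≠ ∞ := by
        obtain ⟨b, hb⟩ := hJ
        exact ne_top_of_le_ne_top (hm b) (measure_mono (Set.biInter_subset_of_mem hb))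
      have hmeas : MeasurableSet ((⋂ i ∈ J, A i) ∪ ⋃ i ∈ K, A i) :=
        (Finset.measurableSet_biInter _ fun i _ => hA i).union
          (Finset.measurableSet_biUnion _ fun i _ => hA i)
      have e := measureReal_union_add_inter (μ := m) (s := ⋃ i ∈ insert a K, A i) hmeas
        (hK _) (measure_union_ne_top hJm (hK _))
      have e1 : (⋃ i ∈ insert a K, A i) ∪ ((⋂ i ∈ J, A i) ∪ ⋃ i ∈ K, A i)
          = (⋂ i ∈ J, A i) ∪ ⋃ i ∈ insert a K, A i := by
        rw [Finset.set_biUnion_insert]; ext x; simp only [Set.mem_union]; tauto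
      have e2 : (⋃ i ∈ insert a K, A i) ∩ ((⋂ i ∈ J, A i) ∪ ⋃ i ∈ K, A i)
          = (⋂ i ∈ Finset.cons a J ha, A i) ∪ ⋃ i ∈ K, A i := by
        rw [Finset.set_biUnion_insert, Finset.cons_eq_insert, Finset.set_biInter_insert]
        ext x; simp only [Set.mem_union, Set.mem_inter_iff]; tauto
      rw [e1, e2] at e
      linarith
    rw [key υ hυ]
    refine (((h (insert a K)).add (ih K)).sub (ih (insert a K))).congr' ?_
    filter_upwards [hμ] with n hn
    rw [key (μ n) hn]
    ring

/-- A continuous tail function on `(0,∞)` means there is no mass on hyperplanes `y i = t`. -/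
lemma measure_coord_eq_zero {d : ℕ} (μ : Measure (Fin d → ℝ)) (i : Fin d) (g : ℝ → ℝ)
    (hfin : ∀ t, 0 < t → μ {y | t < y i} ≠ ∞) (hg : ∀ t, 0 < t → μ.real {y | t < y i} = g t)
    {t : ℝ} (ht : 0 < t) (hc : ContinuousAt g t) : μ {y | y i = t} = 0 := by
  have hev : ∀ᶠ s in 𝓝[<] t, s < t ∧ 0 < s :=
    (eventually_mem_nhdsWithin).and
      ((lt_mem_nhds ht).filter_mono nhdsWithin_le_nhds)
  have hlim : Tendsto (fun s => g s - g t) (𝓝[<] t) (𝓝 0) := by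
    simpa using (hc.mono_left nhdsWithin_le_nhds).sub_const (g t)
  have hfin' : μ {y | y i = t} ≠ ∞ := by
    refine ne_top_of_le_ne_top (hfin (t / 2) (by linarith)) (measure_mono fun y hy => ?_)
    simp only [Set.mem_ofPred_eq] at hy ⊢
    linarith
  have hle : μ.real {y | y i = t} ≤ 0 := by
    refine ge_of_tendsto hlim ?_
    filter_upwards [hev] with s hs
    rw [← hg s hs.2, ← hg t ht, le_sub_iff_add_le, ← measureReal_union ?_ (by measurability) hfin'
      (hfin t ht)]
    · refine measureReal_mono ?_ (hfin s hs.2)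
      rintro y (hy | hy) <;> simp only [Set.mem_ofPred_eq] at hy ⊢ <;> linarith [hs.1]
    · exact Set.disjoint_left.2 fun y hy hy' => by
        simp only [Set.mem_ofPred_eq] at hy hy'; linarith
  exact (measureReal_eq_zero_iff hfin').1 (le_antisymm hle measureReal_nonneg)

/-- Exchange of the integration order for the integral of a df. -/
lemma integral_df_eq {d : ℕ} (μ ρ : Measure (Fin d → ℝ)) [SFinite μ] [IsProbabilityMeasure ρ]
    (hfin : ∀ᵐ z ∂ρ, μ {x | ∀ i, z i ≤ x i} < ∞) :
    ∫ x, df ρ x ∂μ = ∫ z, μ.real {x | ∀ i, z i ≤ x i} ∂ρ := by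
  have hS : MeasurableSet {p : (Fin d → ℝ) × (Fin d → ℝ) | ∀ i, p.2 i ≤ p.1 i} := by
    measurability
  have hm1 := measurable_measure_prodMk_left (ν := ρ) hS
  have hm2 := measurable_measure_prodMk_right (μ := μ) hS
  have h1 := Measure.prod_apply (μ := μ) (ν := ρ) hS
  have h2 := Measure.prod_apply_symm (μ := μ) (ν := ρ) hS
  have e1 := integral_toReal (μ := μ) hm1.aemeasurable (ae_of_all _ fun x => measure_lt_top ρ _)
  have e2 := integral_toReal (μ := ρ) hm2.aemeasurable hfin
  exact e1.trans ((congrArg ENNReal.toReal (h1.symm.trans h2)).trans e2.symm)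

lemma measurable_measureReal_upper {d : ℕ} (μ : Measure (Fin d → ℝ)) [SFinite μ] :
    Measurable (fun z : Fin d → ℝ => μ.real {x | ∀ i, z i ≤ x i}) := by
  have hS : MeasurableSet {p : (Fin d → ℝ) × (Fin d → ℝ) | ∀ i, p.2 i ≤ p.1 i} := by
    measurability
  exact (measurable_measure_prodMk_right (μ := μ) hS).ennreal_toReal

lemma HasFrechetMarginals.ae_pos {d : ℕ} {ρ : Measure (Fin d → ℝ)} [IsProbabilityMeasure ρ]
    (h : HasFrechetMarginals ρ) : ∀ᵐ z ∂ρ, ∀ i, 0 < z i := by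
  refine ae_all_iff.2 fun i => ?_
  have h0 : ρ.real {y | y i ≤ 0} = 0 := by
    simpa [marg, frechet, measureReal_def] using h i 0
  rw [ae_iff]
  simpa using (measureReal_eq_zero_iff).1 h0

/-- The reciprocal of a unit Fréchet coordinate is integrable. -/
lemma HasFrechetMarginals.integrable_inv {d : ℕ} {ρ : Measure (Fin d → ℝ)}
    [IsProbabilityMeasure ρ] (h : HasFrechetMarginals ρ) (i : Fin d) :
    Integrable (fun z : Fin d → ℝ => 1 / z i) ρ := by
  have hm : Measurable (fun z : Fin d → ℝ => 1 / z i) :=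
    measurable_const.div (measurable_pi_apply i)
  have hnn : 0 ≤ᵐ[ρ] fun z : Fin d → ℝ => 1 / z i := by
    filter_upwards [h.ae_pos] with z hz
    exact (one_div_pos.2 (hz i)).le
  refine ⟨hm.aestronglyMeasurable, ?_⟩
  rw [hasFiniteIntegral_iff_ofReal hnn, lintegral_eq_lintegral_meas_le _ hnn hm.aemeasurable]
  have hexp : IntegrableOn (fun t : ℝ => Real.exp (-t)) (Set.Ioi 0) :=
    integrableOn_exp_neg_Ioi 0
  refine lt_of_le_of_lt (setLIntegral_mono' measurableSet_Ioi fun t ht => ?_)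
    ((hasFiniteIntegral_iff_ofReal (ae_of_all _ fun t => (Real.exp_pos _).le)).1 hexp.2)
  have ht0 : 0 < t := ht
  have hmarg := h i (1 / t)
  rw [frechet, if_pos (one_div_pos.2 ht0), one_div_one_div] at hmarg
  rw [← hmarg, marg, ENNReal.ofReal_toReal (measure_ne_top _ _)]
  refine measure_mono fun z hz => ?_
  have hz' : t ≤ 1 / z i := hz
  have hzi : 0 < z i := one_div_pos.1 (ht0.trans_le hz')
  exact (le_one_div ht0 hzi).1 hz'

lemma HasFrechetMarginals.measureReal_coord_le {d : ℕ} {ρ : Measure (Fin d → ℝ)}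
    (h : HasFrechetMarginals ρ) (i : Fin d) {t : ℝ}
    (ht : 0 < t) : ρ.real {y | y i ≤ t} = Real.exp (-(1 / t)) := by
  have h := h i t
  rwa [frechet, if_pos ht] at h

lemma tendsto_nat_mul_one_sub_rpow {a : ℝ} (ha : 0 < a) :
    Tendsto (fun n : ℕ => (n : ℝ) * (1 - a ^ ((n : ℝ)⁻¹))) atTop (𝓝 (-Real.log a)) := by
  have hd : HasDerivAt (fun t : ℝ => a ^ t) (Real.log a) 0 := by
    simpa using (Real.hasStrictDerivAt_const_rpow ha 0).hasDerivAt
  have h := hd.tendsto_slope_zero_right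
  have hn : Tendsto (fun n : ℕ => (n : ℝ)⁻¹) atTop (𝓝[>] 0) :=
    tendsto_inv_atTop_nhdsGT_zero.comp tendsto_natCast_atTop_atTop
  refine (h.comp hn).neg.congr fun n => ?_
  simp
  ring

section Exponent

variable {d : ℕ} {ρH υ : Measure (Fin d → ℝ)} [IsProbabilityMeasure ρH]
  {ν : ℕ → Measure (Fin d → ℝ)}

lemma measureReal_lower_eq_rpow {n : ℕ} {μ : Measure (Fin d → ℝ)} [IsProbabilityMeasure μ]
    (hμ : ∀ x, df μ x = (df ρH x) ^ ((n : ℝ)⁻¹)) (K : Finset (Fin d)) (z : Fin d → ℝ) :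
    μ.real {y | ∀ i ∈ K, y i ≤ z i} = (ρH.real {y | ∀ i ∈ K, y i ≤ z i}) ^ ((n : ℝ)⁻¹) := by
  have h1 := tendsto_df_ite μ K z
  have h2 := ((Real.continuous_rpow_const (q := (n : ℝ)⁻¹) (by positivity)).tendsto _).comp
    (tendsto_df_ite ρH K z)
  exact tendsto_nhds_unique h1 (h2.congr fun m => (hμ _).symm)

lemma measureReal_exists_lt {μ : Measure (Fin d → ℝ)} [IsProbabilityMeasure μ]
    (K : Finset (Fin d)) (z : Fin d → ℝ) :
    μ.real {y | ∃ i ∈ K, z i < y i} = 1 - μ.real {y | ∀ i ∈ K, y i ≤ z i} := by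
  rw [← probReal_compl_eq_one_sub (by measurability)]
  congr 1
  ext y
  simp

lemma measureReal_coord_gt_eq {n : ℕ} {μ : Measure (Fin d → ℝ)} [IsProbabilityMeasure μ]
    (hHm : HasFrechetMarginals ρH)
    (hμ : ∀ x, df μ x = (df ρH x) ^ ((n : ℝ)⁻¹)) (i : Fin d) {t : ℝ} (ht : 0 < t) :
    μ.real {y | t < y i} = 1 - Real.exp (-(1 / t)) ^ ((n : ℝ)⁻¹) := by
  have h1 := measureReal_exists_lt (μ := μ) {i} (fun _ => t)
  rw [measureReal_lower_eq_rpow hμ] at h1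
  simpa [-one_div, hHm.measureReal_coord_le i ht] using h1

lemma df_pos_of_roots (hHm : HasFrechetMarginals ρH)
    (hν : ∀ n : ℕ, 1 ≤ n → IsProbabilityMeasure (ν n) ∧
      ∀ x, df (ν n) x = (df ρH x) ^ ((n : ℝ)⁻¹))
    {z : Fin d → ℝ} (hz : ∀ i, 0 < z i) : 0 < df ρH z := by
  refine lt_of_le_of_ne ENNReal.toReal_nonneg fun h0 => ?_
  have hlim : Tendsto (fun n : ℕ => ∑ i, (1 - Real.exp (-(1 / z i)) ^ ((n : ℝ)⁻¹))) atTop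
      (𝓝 (∑ i : Fin d, (1 - Real.exp (-(1 / z i)) ^ (0 : ℝ)))) := by
    refine tendsto_finsetSum _ fun i _ => tendsto_const_nhds.sub ?_
    exact ((Real.continuous_const_rpow (Real.exp_pos _).ne').tendsto 0).comp
      (tendsto_inv_atTop_zero.comp tendsto_natCast_atTop_atTop)
  have hge : ∀ᶠ n : ℕ in atTop, 1 ≤ ∑ i, (1 - Real.exp (-(1 / z i)) ^ ((n : ℝ)⁻¹)) := by
    filter_upwards [eventually_ge_atTop 1] with n hn
    obtain ⟨hp, hdf⟩ := hν n hn
    have hz0 : (ν n).real {y | ∀ i ∈ Finset.univ, y i ≤ z i} = 0 := by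
      have := hdf z
      rw [← h0, Real.zero_rpow (by positivity)] at this
      simpa [df, measureReal_def] using this
    have h1 := measureReal_exists_lt (μ := ν n) Finset.univ z
    rw [hz0, sub_zero] at h1
    refine h1.symm.trans_le ?_
    have hU : {y : Fin d → ℝ | ∃ i ∈ Finset.univ, z i < y i} = ⋃ i, {y | z i < y i} := by
      ext; simp
    rw [hU]
    refine (measureReal_iUnion_fintype_le _).trans (le_of_eq ?_)
    exact Finset.sum_congr rfl fun i _ => measureReal_coord_gt_eq hHm hdf i (hz i)
  have := ge_of_tendsto hlim hge
  norm_num at this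

lemma IsExponentMeasure.ne_top (hd : 1 ≤ d) (hHm : HasFrechetMarginals ρH)
    (hexp : IsExponentMeasure ρH υ) (hpos : ∀ z : Fin d → ℝ, (∀ i, 0 < z i) → 0 < df ρH z)
    (z : Fin d → ℝ) (hz : ∀ i, 0 < z i) : υ {y | ∃ i, z i < y i} ≠ ∞ := by
  intro h
  have h1 := hexp z hz
  rw [h, ENNReal.toReal_top] at h1
  have h2 : df ρH z ≤ Real.exp (-(1 / z ⟨0, hd⟩)) := by
    rw [← hHm.measureReal_coord_le ⟨0, hd⟩ (hz _)]
    exact measureReal_mono fun y hy => hy _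
  have h3 : Real.exp (-(1 / z ⟨0, hd⟩)) < 1 := by
    rw [Real.exp_lt_one_iff]
    linarith [one_div_pos.2 (hz ⟨0, hd⟩)]
  linarith [Real.log_neg (hpos z hz) (h2.trans_lt h3)]

lemma IsExponentMeasure.measureReal_exists_mem_lt
    (hexp : IsExponentMeasure ρH υ) (hpos : ∀ z : Fin d → ℝ, (∀ i, 0 < z i) → 0 < df ρH z)
    (hfin : ∀ x : Fin d → ℝ, (∀ i, 0 < x i) → υ {y | ∃ i, x i < y i} ≠ ∞)
    (K : Finset (Fin d)) {z : Fin d → ℝ} (hz : ∀ i, 0 < z i) :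
    υ.real {y | ∃ i ∈ K, z i < y i} = -Real.log (ρH.real {y | ∀ i ∈ K, y i ≤ z i}) := by
  have hK : 0 < ρH.real {y | ∀ i ∈ K, y i ≤ z i} :=
    (hpos z hz).trans_le (measureReal_mono fun y hy i _ => hy i)
  have h1 := tendsto_measureReal_exists_lt_ite υ hfin K z hz
  have h2 := ((Real.continuousAt_log hK.ne').tendsto.comp (tendsto_df_ite ρH K z)).neg
  refine tendsto_nhds_unique h1 (h2.congr fun m => (hexp _ fun i => ?_).symm)
  split_ifs
  · exact hz i
  · positivity

end Exponent

/-- For `H` max-id with unit Fréchet marginals with exponent measure `υ`,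
`ν n` the probability measure with df `H^{1/n}`, and `Q` a continuous df of a probability
measure on `[0,∞)^d` with unit Fréchet marginals,
`lim_n n ∫ Q dν_n = ∫_{(0,∞)^d} Q dυ  (= λ(Q,H))`. -/
theorem stmt1 {d : ℕ} (hd : 1 ≤ d)
    (ρH ρQ : Measure (Fin d → ℝ))
    [IsProbabilityMeasure ρH] [IsProbabilityMeasure ρQ]
    (hHm : HasFrechetMarginals ρH) (hmaxid : MaxID ρH)
    (υ : Measure (Fin d → ℝ)) (hexp : IsExponentMeasure ρH υ)
    (ν : ℕ → Measure (Fin d → ℝ))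
    (hν : ∀ n : ℕ, 1 ≤ n → IsProbabilityMeasure (ν n) ∧
      ∀ x, df (ν n) x = (df ρH x) ^ ((n : ℝ)⁻¹))
    (hQsupp : SupportedOnNonneg ρQ) (hQm : HasFrechetMarginals ρQ)
    (hQcont : Continuous (df ρQ)) :
    Tendsto (fun n : ℕ => (n : ℝ) * ∫ x, df ρQ x ∂(ν n)) atTop
      (𝓝 (∫ x in posOrthant d, df ρQ x ∂υ)) := by
  have hpos : ∀ z : Fin d → ℝ, (∀ i, 0 < z i) → 0 < df ρH z := fun z hz =>
    df_pos_of_roots hHm hν hz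
  have hfin := hexp.ne_top hd hHm hpos
  let i₀ : Fin d := ⟨0, hd⟩
  have hposm : MeasurableSet (posOrthant d) := by
    unfold posOrthant
    measurability
  have hcoord_fin : ∀ (i : Fin d) (t : ℝ), 0 < t → υ {y | t < y i} ≠ ∞ := fun i t ht =>
    ne_top_of_le_ne_top (hfin (fun _ => t) fun _ => ht) (measure_mono fun y hy => ⟨i, hy⟩)
  have hυcoord : ∀ (i : Fin d) (t : ℝ), 0 < t → υ.real {y | t < y i} = 1 / t := by
    intro i t ht
    have h := hexp.measureReal_exists_mem_lt hpos hfin {i} (z := fun _ => t) fun _ => ht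
    simpa [-one_div, hHm.measureReal_coord_le i ht] using h
  have : SigmaFinite (υ.restrict (posOrthant d)) := by
    refine ⟨⟨⟨fun k => (posOrthant d)ᶜ ∪ {y | 1 / ((k : ℝ) + 1) < y i₀}, fun _ => trivial,
      fun k => ?_, ?_⟩⟩⟩
    · have hk : (0 : ℝ) < 1 / ((k : ℝ) + 1) := by positivity
      refine measure_union_lt_top ?_ ?_
      · rw [Measure.restrict_apply hposm.compl]
        simp
      · exact (Measure.restrict_apply_le _ _).trans_lt (hcoord_fin i₀ _ hk).lt_top
    · refine Set.eq_univ_of_forall fun y => Set.mem_iUnion.2 ?_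
      by_cases hy : y ∈ posOrthant d
      · obtain ⟨k, hk⟩ := exists_nat_one_div_lt (hy i₀)
        exact ⟨k, Or.inr hk⟩
      · exact ⟨0, Or.inl hy⟩
  have hclosed : ∀ (μ : Measure (Fin d → ℝ)) (z : Fin d → ℝ), (∀ i, μ {y | y i = z i} = 0) →
      μ.real {x | ∀ i, z i ≤ x i} = μ.real {x | ∀ i, z i < x i} := by
    intro μ z h
    refine measureReal_congr ?_
    have hne : ∀ᵐ y ∂μ, ∀ i, y i ≠ z i := ae_all_iff.2 fun i => by
      rw [ae_iff]
      simpa using h i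
    filter_upwards [hne] with y hy
    exact propext (forall_congr' fun i => ⟨fun hle => lt_of_le_of_ne hle (hy i).symm, le_of_lt⟩)
  have hυnull : ∀ (i : Fin d) (t : ℝ), 0 < t → υ {y | y i = t} = 0 := fun i t ht =>
    measure_coord_eq_zero υ i (fun t => 1 / t) (hcoord_fin i) (hυcoord i) ht
      (continuousAt_const.div continuousAt_id ht.ne')
  have hνnull : ∀ n : ℕ, 1 ≤ n → ∀ (i : Fin d) (t : ℝ), 0 < t → ν n {y | y i = t} = 0 := by
    intro n hn i t ht
    obtain ⟨hp, hdf⟩ := hν n hn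
    refine measure_coord_eq_zero (ν n) i (fun t => 1 - Real.exp (-(1 / t)) ^ ((n : ℝ)⁻¹))
      (fun t _ => measure_ne_top _ _) (fun t ht => measureReal_coord_gt_eq hHm hdf i ht) ht ?_
    refine continuousAt_const.sub (ContinuousAt.rpow_const ?_ (Or.inl (Real.exp_pos _).ne'))
    exact Real.continuous_exp.continuousAt.comp
      (continuousAt_const.div continuousAt_id ht.ne').neg
  have hupper : ∀ z : Fin d → ℝ, (∀ i, 0 < z i) →
      (υ.restrict (posOrthant d)) {x | ∀ i, z i ≤ x i} = υ {x | ∀ i, z i ≤ x i} := fun z hz =>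
    Measure.restrict_eq_self _ fun x hx i => (hz i).trans_le (hx i)
  have hupper_fin : ∀ᵐ z ∂ρQ, (υ.restrict (posOrthant d)) {x | ∀ i, z i ≤ x i} < ∞ := by
    filter_upwards [hQm.ae_pos] with z hz
    rw [hupper z hz]
    refine lt_of_le_of_lt (measure_mono fun x hx => ?_)
      (hcoord_fin i₀ (z i₀ / 2) (half_pos (hz i₀))).lt_top
    exact (half_lt_self (hz i₀)).trans_le (hx i₀)
  rw [integral_df_eq (υ.restrict (posOrthant d)) ρQ hupper_fin]
  have hmain : Tendsto
      (fun n : ℕ => ∫ z, (n : ℝ) * (ν n).real {x | ∀ i, z i ≤ x i} ∂ρQ) atTop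
      (𝓝 (∫ z, (υ.restrict (posOrthant d)).real {x | ∀ i, z i ≤ x i} ∂ρQ)) := by
    refine tendsto_integral_filter_of_dominated_convergence (fun z => 1 / z i₀) ?_ ?_
      (hQm.integrable_inv i₀) ?_
    · filter_upwards [eventually_ge_atTop 1] with n hn
      have := (hν n hn).1
      exact ((measurable_measureReal_upper (ν n)).const_mul _).aestronglyMeasurable
    · filter_upwards [eventually_ge_atTop 1] with n hn
      filter_upwards [hQm.ae_pos] with z hz
      obtain ⟨hp, hdf⟩ := hν n hn
      have hn0 : (0 : ℝ) < n := by exact_mod_cast hn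
      rw [Real.norm_of_nonneg (by positivity), hclosed _ _ fun i => hνnull n hn i _ (hz i)]
      have h1 : (ν n).real {x | ∀ i, z i < x i} ≤ (ν n).real {x | z i₀ < x i₀} :=
        measureReal_mono fun x hx => hx i₀
      rw [measureReal_coord_gt_eq hHm hdf i₀ (hz i₀), ← Real.exp_mul] at h1
      have h2 := Real.add_one_le_exp (-(1 / z i₀) * (n : ℝ)⁻¹)
      calc (n : ℝ) * (ν n).real {x | ∀ i, z i < x i} ≤ n * (1 / z i₀ * (n : ℝ)⁻¹) := by
            gcongr
            linarith
        _ = 1 / z i₀ := by field_simp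
    · filter_upwards [hQm.ae_pos] with z hz
      rw [measureReal_def, hupper z hz, ← measureReal_def, hclosed υ z fun i => hυnull i _ (hz i)]
      have hunion : ∀ K : Finset (Fin d),
          Tendsto (fun n : ℕ => (n : ℝ) * (ν n).real (⋃ i ∈ K, {y | z i < y i})) atTop
            (𝓝 (υ.real (⋃ i ∈ K, {y : Fin d → ℝ | z i < y i}))) := by
        intro K
        have hU : (⋃ i ∈ K, {y : Fin d → ℝ | z i < y i}) = {y | ∃ i ∈ K, z i < y i} := by
          ext; simp
        rw [hU, hexp.measureReal_exists_mem_lt hpos hfin K hz]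
        have hK : 0 < ρH.real {y | ∀ i ∈ K, y i ≤ z i} :=
          (hpos z hz).trans_le (measureReal_mono fun y hy i _ => hy i)
        refine (tendsto_nat_mul_one_sub_rpow hK).congr' ?_
        filter_upwards [eventually_ge_atTop 1] with n hn
        obtain ⟨hp, hdf⟩ := hν n hn
        rw [measureReal_exists_lt, measureReal_lower_eq_rpow hdf]
      have hνfin : ∀ᶠ n in atTop, ∀ i, ν n {y | z i < y i} ≠ ∞ := by
        filter_upwards [eventually_ge_atTop 1] with n hn i
        have := (hν n hn).1
        exact measure_ne_top _ _
      have h := tendsto_measureReal_biInter_union_biUnion ν υ (fun i => {y | z i < y i})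
        (fun i => by measurability) hνfin (fun i => hcoord_fin i _ (hz i)) hunion
        Finset.univ ⟨i₀, Finset.mem_univ _⟩ ∅
      have hI : (⋂ i ∈ (Finset.univ : Finset (Fin d)), {y : Fin d → ℝ | z i < y i}) ∪
          (⋃ i ∈ (∅ : Finset (Fin d)), {y : Fin d → ℝ | z i < y i})
          = {y | ∀ i, z i < y i} := by
        ext; simp
      rw [hI] at h
      refine h.congr' ?_
      filter_upwards [eventually_ge_atTop 1] with n hn
      rw [hclosed _ _ fun i => hνnull n hn i _ (hz i)]
  refine hmain.congr' ?_
  filter_upwards [eventually_ge_atTop 1] with n hn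
  have := (hν n hn).1
  rw [integral_df_eq (ν n) ρQ (ae_of_all _ fun z => measure_lt_top _ _), integral_const_mul]
end

section
/- Let d ≥ 1, let H and Q be max-stable dfs with unit Fréchet marginals, and let μ_H be the Borel probability measure with df H. Let F and G be continuous dfs of Borel probability measures ρ_F, ρ_G on [0,∞)^d such that F ∈ MDA(H), G ∈ MDA(Q) with norming constants a_n = n, and such that for each i ≤ d, lim_{x→∞} (1 − F_i(x))/(1 − G_i(x)) = c_i for some c_i ∈ (0,∞). For each n let σ_n be the Borel probability measure with df F^n (the law of the componentwise maximum of n iid random vectors with law ρ_F). Then lim_{n→∞} n ∫_{ℝ^d} (1 − G(x₁,…,x_d)) dσ_n(x) = −∫_{ℝ^d} ln Q(x₁,…,x_d) dμ_H(x) = μ(Q,H). -/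
open MeasureTheory Filter Topology ProbabilityTheory
open scoped ENNReal

lemma df_eq_real {d : ℕ} (ρ : Measure (Fin d → ℝ)) (x : Fin d → ℝ) :
    df ρ x = ρ.real (Set.Iic x) := rfl

lemma isPiSystem_Iic_pos (d : ℕ) :
    IsPiSystem (Set.Iic '' {x : Fin d → ℝ | ∀ i, 0 < x i}) := by
  rintro _ ⟨x, hx, rfl⟩ _ ⟨y, hy, rfl⟩ -
  exact ⟨x ⊓ y, fun i => lt_min (hx i) (hy i), Set.Iic_inter_Iic.symm⟩

/-- The half-open box `∏ᵢ (aᵢ, bᵢ]`. -/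
def halfOpenBox {d : ℕ} (a b : Fin d → ℝ) : Set (Fin d → ℝ) :=
  Set.univ.pi fun i => Set.Ioc (a i) (b i)

lemma isPiSystem_halfOpenBox_pos (d : ℕ) :
    IsPiSystem {s | ∃ a b : Fin d → ℝ,
      (∀ i, 0 < a i) ∧ (∀ i, 0 < b i) ∧ halfOpenBox a b = s} := by
  rintro _ ⟨a, b, ha, hb, rfl⟩ _ ⟨a', b', ha', hb', rfl⟩ -
  refine ⟨a ⊔ a', b ⊓ b', fun i => lt_sup_of_lt_left (ha i),
    fun i => lt_min (hb i) (hb' i), ?_⟩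
  simp only [halfOpenBox, Set.pi_inter_distrib.symm, Set.Ioc_inter_Ioc]
  rfl

lemma measurableSet_halfOpenBox {d : ℕ} (a b : Fin d → ℝ) : MeasurableSet (halfOpenBox a b) :=
  MeasurableSet.univ_pi fun _ => measurableSet_Ioc

/-- A box is a lower orthant with finitely many smaller lower orthants removed. -/
lemma halfOpenBox_eq_diff {d : ℕ} (a b : Fin d → ℝ) :
    halfOpenBox a b =
      Set.Iic b \ ⋃ s ∈ Finset.univ.image
        (fun i => Set.Iic (Function.update b i (min (a i) (b i)))), s := by
  ext y
  simp only [halfOpenBox, Set.mem_pi, Set.mem_univ, true_implies, Set.mem_Ioc, Finset.mem_image,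
    Finset.mem_univ, true_and, Set.mem_sdiff, Set.mem_iUnion, Set.mem_Iic, not_exists]
  constructor
  · rintro h
    refine ⟨fun i => (h i).2, ?_⟩
    rintro _ ⟨i, rfl⟩ hy
    have := hy i
    simp only [Function.update_self, le_min_iff] at this
    exact (h i).1.not_ge this.1
  · rintro ⟨hb, h⟩ i
    refine ⟨lt_of_not_ge fun hi => h _ ⟨i, rfl⟩ fun j => ?_, hb i⟩
    rcases eq_or_ne j i with rfl | hj
    · simpa using ⟨hi, hb j⟩
    · simpa [hj] using hb j

lemma tendsto_measureReal_halfOpenBox {d : ℕ} {τ : ℕ → Measure (Fin d → ℝ)}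
    {ρ : Measure (Fin d → ℝ)} [∀ n, IsProbabilityMeasure (τ n)] [IsProbabilityMeasure ρ]
    (h : ∀ x, (∀ i, 0 < x i) → Tendsto (fun n => df (τ n) x) atTop (𝓝 (df ρ x)))
    {a b : Fin d → ℝ} (ha : ∀ i, 0 < a i) (hb : ∀ i, 0 < b i) :
    Tendsto (fun n => (τ n).real (halfOpenBox a b)) atTop (𝓝 (ρ.real (halfOpenBox a b))) := by
  set T : Finset (Set (Fin d → ℝ)) := Finset.univ.image
    (fun i => Set.Iic (Function.update b i (min (a i) (b i)))) with hT
  have hTm : MeasurableSet (⋃ s ∈ T, s) := by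
    refine Finset.measurableSet_biUnion T fun s hs => ?_
    obtain ⟨i, -, rfl⟩ := Finset.mem_image.1 hs
    exact measurableSet_Iic
  have hsub : (⋃ s ∈ T, s) ⊆ Set.Iic b := by
    refine Set.iUnion₂_subset fun s hs => ?_
    obtain ⟨i, -, rfl⟩ := Finset.mem_image.1 hs
    exact Set.Iic_subset_Iic.2 (by simp)
  have hreal (μ : Measure (Fin d → ℝ)) [IsProbabilityMeasure μ] :
      μ.real (halfOpenBox a b) = df μ b - μ.real (⋃ s ∈ T, s) := by
    rw [halfOpenBox_eq_diff, measureReal_sdiff hsub hTm, df_eq_real]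
  simp_rw [hreal]
  refine (h b hb).sub ?_
  refine (isPiSystem_Iic_pos d).tendsto_measureReal_biUnion (fun s hs => ?_) ?_ ?_
  · obtain ⟨i, -, rfl⟩ := Finset.mem_image.1 hs
    refine ⟨_, fun j => ?_, rfl⟩
    rcases eq_or_ne j i with rfl | hj
    · simpa using ⟨ha j, hb j⟩
    · simpa [hj] using hb j
  · rintro _ ⟨x, -, rfl⟩
    exact measurableSet_Iic
  · rintro _ ⟨x, hx, rfl⟩
    exact h x hx

/-- If the distribution functions converge on the positive orthant, and each point of `U` has a
box neighbourhood in the orthant eventually contained in `A n`, then the mass of `A n` is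
asymptotically at least the limit mass of `U`. -/
lemma eventually_lt_measureReal_of_box_cover {d : ℕ} {τ : ℕ → Measure (Fin d → ℝ)}
    {ρ : Measure (Fin d → ℝ)} [∀ n, IsProbabilityMeasure (τ n)] [IsProbabilityMeasure ρ]
    (h : ∀ x, (∀ i, 0 < x i) → Tendsto (fun n => df (τ n) x) atTop (𝓝 (df ρ x)))
    {U : Set (Fin d → ℝ)} {A : ℕ → Set (Fin d → ℝ)}
    (hU : ∀ x ∈ U, ∃ a b : Fin d → ℝ, (∀ i, 0 < a i) ∧ (∀ i, a i < x i ∧ x i < b i) ∧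
      ∀ᶠ n in atTop, halfOpenBox a b ⊆ A n) {r : ℝ} (hr : r < ρ.real U) :
    ∀ᶠ n in atTop, r < (τ n).real (A n) := by
  choose! a b ha hab hA using hU
  obtain ⟨t, htU, htc, hcov⟩ := TopologicalSpace.countable_cover_nhdsWithin
    (f := fun x => halfOpenBox (a x) (b x)) (s := U) fun x hx => mem_nhdsWithin_of_mem_nhds <|
      set_pi_mem_nhds Set.finite_univ fun i _ => Ioc_mem_nhds (hab x hx i).1 (hab x hx i).2
  rcases t.eq_empty_or_nonempty with rfl | hne
  · have : U = ∅ := by simpa using hcov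
    subst this
    exact Eventually.of_forall fun n => lt_of_lt_of_le (by simpa using hr) measureReal_nonneg
  obtain ⟨f, rfl⟩ := htc.exists_eq_range hne
  set B : ℕ → Set (Fin d → ℝ) := fun n => halfOpenBox (a (f n)) (b (f n)) with hB
  have hfU (n : ℕ) : f n ∈ U := htU ⟨n, rfl⟩
  have hUB : U ⊆ ⋃ n, B n := by simpa using hcov
  have hlim : Tendsto (fun i => ρ.real (Set.accumulate B i)) atTop (𝓝 (ρ.real (⋃ i, B i))) :=
    (ENNReal.tendsto_toReal (by finiteness)).comp tendsto_measure_iUnion_accumulate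
  obtain ⟨N, hN⟩ := ((tendsto_order.1 hlim).1 r (hr.trans_le (measureReal_mono hUB))).exists
  have hacc : Set.accumulate B N = ⋃ s ∈ (Finset.range (N + 1)).image B, s := by
    simp [Set.accumulate_def]
  rw [hacc] at hN
  have hconv := (isPiSystem_halfOpenBox_pos d).tendsto_measureReal_biUnion (μ := τ) (ν := ρ)
    (l := atTop) (t := (Finset.range (N + 1)).image B) (fun s hs => by
      obtain ⟨n, -, rfl⟩ := Finset.mem_image.1 hs
      exact ⟨_, _, ha _ (hfU n), fun i => (ha _ (hfU n) i).trans
        ((hab _ (hfU n) i).1.trans (hab _ (hfU n) i).2), rfl⟩)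
    (by rintro _ ⟨a, b, -, -, rfl⟩; exact measurableSet_halfOpenBox a b)
    (by rintro _ ⟨a, b, ha, hb, rfl⟩; exact tendsto_measureReal_halfOpenBox h ha hb)
  have hsub : ∀ᶠ n in atTop, ∀ k ∈ Finset.range (N + 1), B k ⊆ A n :=
    (Finset.eventually_all _).2 fun k _ => hA _ (hfU k)
  filter_upwards [(tendsto_order.1 hconv).1 r hN, hsub] with n hn hs
  refine hn.trans_le (measureReal_mono ?_)
  refine Set.iUnion₂_subset fun s hs' => ?_
  obtain ⟨k, hk, rfl⟩ := Finset.mem_image.1 hs'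
  exact hs k hk

lemma marg_mono {d : ℕ} (ρ : Measure (Fin d → ℝ)) [IsProbabilityMeasure ρ] (i : Fin d) :
    Monotone (marg ρ i) := fun _ _ hst =>
  measureReal_mono (μ := ρ) fun _ hy => le_trans (α := ℝ) hy hst

lemma marg_nonneg {d : ℕ} (ρ : Measure (Fin d → ℝ)) (i : Fin d) (t : ℝ) : 0 ≤ marg ρ i t :=
  ENNReal.toReal_nonneg

lemma marg_le_one {d : ℕ} (ρ : Measure (Fin d → ℝ)) [IsProbabilityMeasure ρ] (i : Fin d)
    (t : ℝ) : marg ρ i t ≤ 1 := measureReal_le_one (μ := ρ)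

lemma df_mono {d : ℕ} (ρ : Measure (Fin d → ℝ)) [IsProbabilityMeasure ρ] : Monotone (df ρ) :=
  fun _ _ hst => measureReal_mono (μ := ρ) fun _ hy i => (hy i).trans (hst i)

lemma df_nonneg {d : ℕ} (ρ : Measure (Fin d → ℝ)) (x : Fin d → ℝ) : 0 ≤ df ρ x :=
  ENNReal.toReal_nonneg

lemma df_le_one {d : ℕ} (ρ : Measure (Fin d → ℝ)) [IsProbabilityMeasure ρ] (x : Fin d → ℝ) :
    df ρ x ≤ 1 := measureReal_le_one (μ := ρ)

lemma measurableSet_coord_le {d : ℕ} (i : Fin d) (t : ℝ) :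
    MeasurableSet {y : Fin d → ℝ | y i ≤ t} :=
  measurableSet_le (measurable_pi_apply i) measurable_const

lemma one_sub_df_le_sum {d : ℕ} (ρ : Measure (Fin d → ℝ)) [IsProbabilityMeasure ρ]
    (x : Fin d → ℝ) : 1 - df ρ x ≤ ∑ i, (1 - marg ρ i (x i)) := by
  have h1 : 1 - df ρ x = ρ.real (Set.Iic x)ᶜ := (probReal_compl_eq_one_sub measurableSet_Iic).symm
  have h2 (i : Fin d) : 1 - marg ρ i (x i) = ρ.real {y | y i ≤ x i}ᶜ :=
    (probReal_compl_eq_one_sub (measurableSet_coord_le i _)).symm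
  simp_rw [h1, h2]
  refine (measureReal_mono fun y hy => ?_).trans (measureReal_iUnion_fintype_le _)
  simpa [Pi.le_def] using hy

lemma df_sub_df_le_sum {d : ℕ} (ρ : Measure (Fin d → ℝ)) [IsProbabilityMeasure ρ]
    (x y : Fin d → ℝ) : df ρ x - df ρ y ≤ ∑ i, |marg ρ i (x i) - marg ρ i (y i)| := by
  have h1 : df ρ x ≤ df ρ y + ρ.real (Set.Iic x \ Set.Iic y) := by
    rw [df_eq_real, df_eq_real, add_comm]
    exact (measureReal_mono (by intro z hz; by_cases h : z ≤ y <;> simp_all)).trans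
      (measureReal_union_le _ _)
  have h2 : ρ.real (Set.Iic x \ Set.Iic y) ≤
      ∑ i, ρ.real ({z | z i ≤ x i} \ {z | z i ≤ y i}) := by
    refine (measureReal_mono fun z hz => ?_).trans (measureReal_iUnion_fintype_le _)
    simp only [Set.mem_sdiff, Set.mem_Iic, Pi.le_def, not_forall] at hz
    obtain ⟨hx, i, hi⟩ := hz
    exact Set.mem_iUnion.2 ⟨i, hx i, hi⟩
  have h3 (i : Fin d) : ρ.real ({z | z i ≤ x i} \ {z | z i ≤ y i}) ≤
      |marg ρ i (x i) - marg ρ i (y i)| := by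
    rcases le_total (x i) (y i) with h | h
    · have : ({z : Fin d → ℝ | z i ≤ x i} \ {z | z i ≤ y i}) = ∅ :=
        Set.sdiff_eq_empty.2 fun z hz => le_trans (α := ℝ) hz h
      simp [this]
    · have hsub : {z : Fin d → ℝ | z i ≤ y i} ⊆ {z | z i ≤ x i} :=
        fun z hz => le_trans (α := ℝ) hz h
      rw [measureReal_sdiff hsub (measurableSet_coord_le i _)]
      exact le_abs_self _
  linarith [Finset.sum_le_sum fun i (_ : i ∈ Finset.univ) => h3 i]

lemma continuous_df_of_continuous_marg {d : ℕ} (ρ : Measure (Fin d → ℝ))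
    [IsProbabilityMeasure ρ] (h : ∀ i, Continuous (marg ρ i)) : Continuous (df ρ) := by
  refine continuous_iff_continuousAt.2 fun x => tendsto_iff_dist_tendsto_zero.2 ?_
  have hlim : Tendsto (fun y : Fin d → ℝ => ∑ i, |marg ρ i (y i) - marg ρ i (x i)|) (𝓝 x)
      (𝓝 0) := by
    have : Continuous fun y : Fin d → ℝ => ∑ i, |marg ρ i (y i) - marg ρ i (x i)| := by
      fun_prop
    simpa using this.tendsto x
  refine squeeze_zero (fun _ => dist_nonneg) (fun y => ?_) hlim
  rw [Real.dist_eq, abs_sub_le_iff]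
  refine ⟨df_sub_df_le_sum ρ y x, (df_sub_df_le_sum ρ x y).trans_eq ?_⟩
  simp_rw [abs_sub_comm]

lemma continuous_frechet : Continuous frechet := by
  have hpos : ∀ x : ℝ, 0 < x → ContinuousAt frechet x := fun x hx => by
    have : ContinuousAt (fun y : ℝ => Real.exp (-(1 / y))) x := by
      have := hx.ne'
      fun_prop (disch := assumption)
    refine this.congr ?_
    filter_upwards [lt_mem_nhds hx] with y hy
    simp [frechet, hy]
  refine continuous_iff_continuousAt.2 fun x => ?_
  rcases lt_trichotomy x 0 with hx | rfl | hx
  · refine (continuousAt_const (y := (0 : ℝ))).congr ?_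
    filter_upwards [gt_mem_nhds hx] with y hy
    simp [frechet, not_lt.2 (le_of_lt hy)]
  · refine continuousAt_iff_continuous_left'_right'.2 ⟨?_, ?_⟩
    · refine (continuousWithinAt_const (b := (0 : ℝ))).congr (fun y hy => ?_) (by simp [frechet])
      simp [frechet, not_lt.2 (le_of_lt (Set.mem_Iio.1 hy))]
    · have : Tendsto (fun y : ℝ => Real.exp (-(1 / y))) (𝓝[>] 0) (𝓝 0) := by
        simp_rw [one_div]
        exact Real.tendsto_exp_neg_atTop_nhds_zero.comp tendsto_inv_nhdsGT_zero
      have h0 : frechet 0 = 0 := by simp [frechet]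
      rw [ContinuousWithinAt, h0]
      refine this.congr' ?_
      filter_upwards [self_mem_nhdsWithin] with y hy
      simp [frechet, Set.mem_Ioi.1 hy]
  · exact hpos x hx

lemma tendsto_frechet_atTop : Tendsto frechet atTop (𝓝 1) := by
  have : Tendsto (fun y : ℝ => Real.exp (-(1 / y))) atTop (𝓝 1) := by
    have h := (tendsto_inv_atTop_zero (𝕜 := ℝ)).neg
    simpa using! (Real.continuous_exp.tendsto _).comp h
  refine this.congr' ?_
  filter_upwards [eventually_gt_atTop 0] with y hy
  simp [frechet, hy]

lemma HasFrechetMarginals.continuous_df {d : ℕ} {ρ : Measure (Fin d → ℝ)}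
    [IsProbabilityMeasure ρ] (h : HasFrechetMarginals ρ) : Continuous (df ρ) :=
  continuous_df_of_continuous_marg ρ fun i => by
    rw [funext (h i)]; exact continuous_frechet

lemma HasFrechetMarginals.measure_posOrthant {d : ℕ} {ρ : Measure (Fin d → ℝ)}
    [IsProbabilityMeasure ρ] (h : HasFrechetMarginals ρ) : ∀ᵐ x ∂ρ, x ∈ posOrthant d := by
  refine ae_all_iff.2 fun i => ?_
  have h0 : ρ.real {y | y i ≤ 0} = 0 := (h i 0).trans (by simp [frechet])
  have := (measureReal_eq_zero_iff).1 h0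
  simpa [ae_iff] using this

/-- A max-stable distribution function with unit Fréchet marginals is positive on the positive
orthant. -/
lemma MaxStable.df_pos {d : ℕ} {ρ : Measure (Fin d → ℝ)} [IsProbabilityMeasure ρ]
    (hs : MaxStable ρ) (hm : HasFrechetMarginals ρ) {x : Fin d → ℝ} (hx : ∀ i, 0 < x i) :
    0 < df ρ x := by
  refine (df_nonneg ρ x).lt_of_ne fun h0 => ?_
  have hlim : Tendsto (fun t : ℝ => ∑ i, (1 - marg ρ i (t * x i))) atTop (𝓝 0) := by
    have : Tendsto (fun t : ℝ => ∑ i, (1 - marg ρ i (t * x i))) atTop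
        (𝓝 (∑ _i : Fin d, ((1 : ℝ) - 1))) := by
      refine tendsto_finsetSum _ fun i _ => tendsto_const_nhds.sub ?_
      rw [funext (hm i)]
      exact tendsto_frechet_atTop.comp (tendsto_id.atTop_mul_const (hx i))
    simpa using this
  obtain ⟨t, ht, ht0⟩ := ((hlim.eventually (gt_mem_nhds zero_lt_one)).and
    (eventually_gt_atTop 0)).exists
  have h1 := one_sub_df_le_sum ρ fun i => t * x i
  rw [hs t ht0 x hx, ← h0, Real.zero_rpow (by positivity)] at h1
  linarith

/-- If `uₙ ^ n → q > 0` with `uₙ ∈ [0, 1]`, then `n (1 - uₙ) → -log q`. -/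
lemma tendsto_mul_one_sub_of_tendsto_pow {u : ℕ → ℝ} {q : ℝ} (hq : 0 < q)
    (hu : ∀ n, 0 ≤ u n) (h : Tendsto (fun n => u n ^ n) atTop (𝓝 q)) :
    Tendsto (fun n : ℕ => (n : ℝ) * (1 - u n)) atTop (𝓝 (-Real.log q)) := by
  have hlog : Tendsto (fun n : ℕ => -((n : ℝ) * Real.log (u n))) atTop (𝓝 (-Real.log q)) := by
    refine Tendsto.neg ?_
    simpa [Function.comp_def] using (Real.continuousAt_log hq.ne').tendsto.comp h
  have hupos : ∀ᶠ n : ℕ in atTop, 0 < u n := by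
    filter_upwards [h.eventually (lt_mem_nhds hq), eventually_ge_atTop 1] with n hn h1
    refine (hu n).lt_of_ne fun h0 => ?_
    rw [← h0, zero_pow (by omega)] at hn
    exact lt_irrefl _ hn
  have hu1 : Tendsto u atTop (𝓝 1) := by
    have h0 : Tendsto (fun n : ℕ => -(-((n : ℝ) * Real.log (u n)) * (n : ℝ)⁻¹)) atTop (𝓝 0) := by
      simpa using (hlog.mul (tendsto_inv_atTop_nhds_zero_nat (𝕜 := ℝ))).neg
    have := (Real.continuous_exp.tendsto 0).comp h0
    rw [Real.exp_zero] at this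
    refine this.congr' ?_
    filter_upwards [hupos, eventually_ge_atTop 1] with n hn h1
    have : (n : ℝ) ≠ 0 := by positivity
    have h2 : -(-((n : ℝ) * Real.log (u n)) * (n : ℝ)⁻¹) = Real.log (u n) := by field_simp
    simp only [Function.comp_apply, h2, Real.exp_log hn]
  have hlow : Tendsto (fun n : ℕ => u n * -((n : ℝ) * Real.log (u n))) atTop
      (𝓝 (-Real.log q)) := by
    simpa using hu1.mul hlog
  refine tendsto_of_tendsto_of_tendsto_of_le_of_le' hlow hlog ?_ ?_
  · filter_upwards [hupos] with n hn
    have h1 : 1 - (u n)⁻¹ ≤ Real.log (u n) := Real.one_sub_inv_le_log_of_pos hn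
    have h2 : u n * -Real.log (u n) ≤ 1 - u n := by
      have := mul_le_mul_of_nonneg_left h1 hn.le
      rw [mul_sub, mul_inv_cancel₀ hn.ne'] at this
      linarith
    calc _ = (n : ℝ) * (u n * -Real.log (u n)) := by ring
      _ ≤ _ := by gcongr
  · filter_upwards [hupos] with n hn
    have := Real.log_le_sub_one_of_pos hn
    calc (n : ℝ) * (1 - u n) ≤ n * -Real.log (u n) := by gcongr; linarith
      _ = _ := by ring

lemma tendsto_df_update_marg {d : ℕ} (ρ : Measure (Fin d → ℝ)) [IsProbabilityMeasure ρ]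
    (i : Fin d) (t : ℝ) :
    Tendsto (fun m : ℕ => df ρ (Function.update (fun _ => (m : ℝ)) i t)) atTop
      (𝓝 (marg ρ i t)) := by
  have hmono : Monotone fun m : ℕ => Set.Iic (Function.update (fun _ => (m : ℝ)) i t) := by
    refine fun m n hmn => Set.Iic_subset_Iic.2 fun j => ?_
    rcases eq_or_ne j i with rfl | hj
    · simp
    · simpa [hj] using hmn
  have hU : ⋃ m : ℕ, Set.Iic (Function.update (fun _ : Fin d => (m : ℝ)) i t) =
      {y | y i ≤ t} := by
    ext y
    simp only [Set.mem_iUnion, Set.mem_Iic, Set.mem_ofPred_eq]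
    refine ⟨fun ⟨m, hm⟩ => by simpa using hm i, fun hy => ?_⟩
    obtain ⟨m, hm⟩ := exists_nat_ge (∑ j, |y j|)
    refine ⟨m, fun j => ?_⟩
    rcases eq_or_ne j i with rfl | hj
    · simpa using hy
    · simpa [hj] using ((le_abs_self _).trans (Finset.single_le_sum
        (f := fun j => |y j|) (fun _ _ => abs_nonneg _) (Finset.mem_univ j))).trans hm
  have := tendsto_measure_iUnion_atTop (μ := ρ) hmono
  rw [hU] at this
  exact (ENNReal.tendsto_toReal (by finiteness)).comp this

/-- The marginals of a measure with distribution function `Fⁿ` are the powers `Fᵢⁿ`. -/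
lemma marg_eq_pow_of_df_eq_pow {d : ℕ} {ρ ν : Measure (Fin d → ℝ)} [IsProbabilityMeasure ρ]
    [IsProbabilityMeasure ν] {n : ℕ} (h : ∀ x, df ν x = df ρ x ^ n) (i : Fin d) (t : ℝ) :
    marg ν i t = marg ρ i t ^ n := by
  refine tendsto_nhds_unique (tendsto_df_update_marg ν i t) ?_
  simp_rw [h]
  exact (tendsto_df_update_marg ρ i t).pow n

/-- Probability integral transform bound for the maximum of `n` independent variables. -/
lemma measure_marg_le_le_pow {d : ℕ} {ρ ν : Measure (Fin d → ℝ)} [IsProbabilityMeasure ρ]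
    [IsProbabilityMeasure ν] {n : ℕ} (h : ∀ x, df ν x = df ρ x ^ n) (i : Fin d) (u : ℝ) :
    ν {y | marg ρ i (y i) ≤ u} ≤ ENNReal.ofReal (u ^ n) := by
  have hm : MeasurableSet {t | marg ρ i t ≤ u} :=
    measurableSet_le (marg_mono ρ i).measurable measurable_const
  have hi : Measurable fun y : Fin d → ℝ => y i := measurable_pi_apply i
  have hmap : ν {y | marg ρ i (y i) ≤ u} = ν.map (fun y => y i) {t | marg ρ i t ≤ u} :=
    (Measure.map_apply hi hm).symm
  rw [hmap, hm.measure_eq_iSup_isCompact_of_ne_top (by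
    rw [← hmap]; finiteness)]
  refine iSup₂_le fun K hK => iSup_le fun hKc => ?_
  rcases K.eq_empty_or_nonempty with rfl | hne
  · simp
  obtain ⟨t, htK, ht⟩ := hKc.exists_isGreatest hne
  calc ν.map (fun y => y i) K ≤ ν.map (fun y => y i) (Set.Iic t) := measure_mono ht
    _ = ν {y | y i ≤ t} := Measure.map_apply hi measurableSet_Iic
    _ = ENNReal.ofReal (marg ν i t) := (ENNReal.ofReal_toReal (by finiteness)).symm
    _ ≤ ENNReal.ofReal (u ^ n) := by
      rw [marg_eq_pow_of_df_eq_pow h]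
      exact ENNReal.ofReal_le_ofReal (pow_le_pow_left₀ (marg_nonneg ρ i t) (hK htK) n)

/-- Tail-equivalent marginals have globally comparable tails. -/
lemma exists_one_sub_marg_le {d : ℕ} {ρF ρG : Measure (Fin d → ℝ)} [IsProbabilityMeasure ρF]
    [IsProbabilityMeasure ρG] {c : ℝ} (hc : 0 < c) {i : Fin d}
    (h : Tendsto (fun x : ℝ => (1 - marg ρF i x) / (1 - marg ρG i x)) atTop (𝓝 c)) :
    ∃ K : ℝ, 0 < K ∧ ∀ t, 1 - marg ρG i t ≤ K * (1 - marg ρF i t) := by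
  obtain ⟨t₀, ht₀⟩ := eventually_atTop.1 (h.eventually (lt_mem_nhds (half_lt_self hc)))
  have key (t : ℝ) (ht : t₀ ≤ t) : 0 < 1 - marg ρG i t ∧
      c / 2 * (1 - marg ρG i t) < 1 - marg ρF i t := by
    have h1 := ht₀ t ht
    have h2 : 0 < 1 - marg ρG i t := by
      refine (sub_nonneg.2 (marg_le_one ρG i t)).lt_of_ne fun h0 => ?_
      rw [← h0, div_zero] at h1
      linarith
    exact ⟨h2, (lt_div_iff₀ h2).1 h1⟩
  have hF₀ : 0 < 1 - marg ρF i t₀ :=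
    (mul_pos (half_pos hc) (key t₀ le_rfl).1).trans (key t₀ le_rfl).2
  refine ⟨2 / c + 1 / (1 - marg ρF i t₀), by positivity, fun t => ?_⟩
  have hFt : 0 ≤ 1 - marg ρF i t := sub_nonneg.2 (marg_le_one ρF i t)
  rw [add_mul]
  rcases le_total t₀ t with ht | ht
  · have h1 : 1 - marg ρG i t ≤ 2 / c * (1 - marg ρF i t) := by
      rw [div_mul_eq_mul_div, le_div_iff₀ hc]
      linarith [(key t ht).2]
    have : 0 ≤ 1 / (1 - marg ρF i t₀) * (1 - marg ρF i t) := by positivity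
    linarith
  · have h1 : 1 ≤ 1 / (1 - marg ρF i t₀) * (1 - marg ρF i t) := by
      rw [div_mul_eq_mul_div, le_div_iff₀ hF₀]
      linarith [marg_mono ρF i ht]
    have : 0 ≤ 2 / c * (1 - marg ρF i t) := by positivity
    linarith [marg_nonneg ρG i t]

/-- Exponential tail bound for `n (1 - G)` under the law of the componentwise maximum. -/
lemma measure_mul_one_sub_df_lt_le {d : ℕ} {ρF ρG ν : Measure (Fin d → ℝ)}
    [IsProbabilityMeasure ρF] [IsProbabilityMeasure ρG] [IsProbabilityMeasure ν] {n : ℕ}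
    (hd1 : 1 ≤ d) (hn : 1 ≤ n) (hν : ∀ x, df ν x = df ρF x ^ n) {K : Fin d → ℝ} (hK : ∀ i, 0 < K i)
    (hKle : ∀ i t, 1 - marg ρG i t ≤ K i * (1 - marg ρF i t)) (s : ℝ) :
    ν {x | s < n * (1 - df ρG x)} ≤ ∑ i, ENNReal.ofReal (Real.exp (-(d * K i)⁻¹ * s)) := by
  have hn0 : (0 : ℝ) < n := by exact_mod_cast hn
  have hsub : {x : Fin d → ℝ | s < n * (1 - df ρG x)} ⊆
      ⋃ i, {y | marg ρF i (y i) ≤ Real.exp (-(d * K i)⁻¹ * s / n)} := by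
    intro x hx
    by_contra hcon
    simp only [Set.mem_iUnion, Set.mem_ofPred_eq, not_exists, not_le] at hcon
    have hi (i : Fin d) : 1 - marg ρG i (x i) ≤ s / (n * d) := by
      have h1 := Real.add_one_le_exp (-(d * K i)⁻¹ * s / n)
      have h2 : 1 - marg ρF i (x i) ≤ (d * K i)⁻¹ * s / n := by
        have := hcon i
        rw [neg_mul, neg_div] at *
        linarith
      have hKi := hK i
      have hdi : (0 : ℝ) < d := by exact_mod_cast hd1
      calc _ ≤ K i * (1 - marg ρF i (x i)) := hKle i _
        _ ≤ K i * ((d * K i)⁻¹ * s / n) := by gcongr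
        _ = s / (n * d) := by field_simp
    have hs : (s : ℝ) < n * ∑ i : Fin d, s / (n * d) :=
      lt_of_lt_of_le hx (by
        gcongr
        exact (one_sub_df_le_sum ρG x).trans (Finset.sum_le_sum fun i _ => hi i))
    have hd0 : (0 : ℝ) < d := by exact_mod_cast hd1
    simp only [Finset.sum_const, Finset.card_univ, Fintype.card_fin, nsmul_eq_mul] at hs
    field_simp at hs
    exact lt_irrefl _ hs
  refine (measure_mono hsub).trans ((measure_iUnion_fintype_le _ _).trans ?_)
  refine Finset.sum_le_sum fun i _ => (measure_marg_le_le_pow hν i _).trans_eq ?_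
  rw [← Real.exp_nat_mul]
  congr 2
  field_simp

/-- Shrinking boxes around a point of the positive orthant. -/
lemma exists_box_of_continuousAt {d : ℕ} {g : (Fin d → ℝ) → ℝ} {x : Fin d → ℝ}
    (hx : ∀ i, 0 < x i) (hg : ContinuousAt g x) {V : Set ℝ} (hV : V ∈ 𝓝 (g x)) :
    ∃ a b : Fin d → ℝ, (∀ i, 0 < a i) ∧ (∀ i, a i < x i ∧ x i < b i) ∧ g a ∈ V ∧ g b ∈ V := by
  have hpath (e : ℝ) : Tendsto (fun δ : ℝ => fun i => x i + e * δ) (𝓝[>] 0) (𝓝 x) := by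
    have : Continuous fun δ : ℝ => fun i => x i + e * δ := by fun_prop
    simpa using (this.tendsto 0).mono_left nhdsWithin_le_nhds
  have hev (e : ℝ) : ∀ᶠ δ : ℝ in 𝓝[>] 0,
      (∀ i, 0 < x i + e * δ) ∧ g (fun i => x i + e * δ) ∈ V :=
    (eventually_all.2 fun i =>
      ((tendsto_pi_nhds.1 (hpath e)) i).eventually (lt_mem_nhds (hx i))).and
      ((hpath e).eventually (hg hV))
  obtain ⟨δ, ⟨h1, h2⟩, h3⟩ := (((hev (-1)).and (hev 1)).and self_mem_nhdsWithin).exists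
  have hδ : 0 < δ := h3
  exact ⟨_, _, h1.1, fun i => ⟨by linarith, by linarith⟩, h1.2, h2.2⟩

/-- Convergence of tail probabilities of `gₙ` under `τₙ`, for antitone `gₙ` converging pointwise
on the positive orthant to a continuous limit. -/
lemma tendsto_measure_lt_of_antitone {d : ℕ} {τ : ℕ → Measure (Fin d → ℝ)}
    {ρ : Measure (Fin d → ℝ)} [∀ n, IsProbabilityMeasure (τ n)] [IsProbabilityMeasure ρ]
    (h : ∀ x, (∀ i, 0 < x i) → Tendsto (fun n => df (τ n) x) atTop (𝓝 (df ρ x)))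
    (hρ : ∀ᵐ x ∂ρ, x ∈ posOrthant d)
    {f : ℕ → (Fin d → ℝ) → ℝ} {g : (Fin d → ℝ) → ℝ}
    (hfanti : ∀ n, Antitone (f n)) (hfm : ∀ n, Measurable (f n)) (hgm : Measurable g)
    (hgc : ∀ x ∈ posOrthant d, ContinuousAt g x)
    (hfg : ∀ x ∈ posOrthant d, Tendsto (fun n => f n x) atTop (𝓝 (g x)))
    {s : ℝ} (hs : ρ {x | g x = s} = 0) :
    Tendsto (fun n => τ n {x | s < f n x}) atTop (𝓝 (ρ {x | s < g x})) := by
  have hposinter (A : Set (Fin d → ℝ)) : A =ᵐ[ρ] (A ∩ posOrthant d : Set (Fin d → ℝ)) := by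
    filter_upwards [hρ] with x hx
    exact propext ⟨fun hA => ⟨hA, hx⟩, fun hA => hA.1⟩
  have hlower {r : ℝ} (hr : r < ρ.real {x | s < g x}) :
      ∀ᶠ n in atTop, r < (τ n).real {x | s < f n x} := by
    have heq : ρ.real {x | s < g x} = ρ.real ({x | s < g x} ∩ posOrthant d) :=
      measureReal_congr (hposinter _)
    rw [heq] at hr
    refine eventually_lt_measureReal_of_box_cover h (fun x hx => ?_) hr
    obtain ⟨a, b, ha, hab, -, hb⟩ := exists_box_of_continuousAt hx.2 (hgc x hx.2)
      (lt_mem_nhds hx.1)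
    have hbpos : b ∈ posOrthant d := fun i => (hx.2 i).trans (hab i).2
    refine ⟨a, b, ha, hab, ?_⟩
    filter_upwards [(hfg b hbpos).eventually (lt_mem_nhds hb)] with n hn y hy
    exact hn.trans_le (hfanti n fun i => (hy i trivial).2)
  have hupper {r : ℝ} (hr : r < ρ.real {x | g x < s}) :
      ∀ᶠ n in atTop, r < (τ n).real {x | f n x < s} := by
    have heq : ρ.real {x | g x < s} = ρ.real ({x | g x < s} ∩ posOrthant d) :=
      measureReal_congr (hposinter _)
    rw [heq] at hr
    refine eventually_lt_measureReal_of_box_cover h (fun x hx => ?_) hr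
    obtain ⟨a, b, ha, hab, ha', -⟩ := exists_box_of_continuousAt hx.2 (hgc x hx.2)
      (gt_mem_nhds hx.1)
    refine ⟨a, b, ha, hab, ?_⟩
    filter_upwards [(hfg a ha).eventually (gt_mem_nhds ha')] with n hn y hy
    exact (hfanti n fun i => (hy i trivial).1.le).trans_lt hn
  have hcompl : ρ.real {x | g x < s} = 1 - ρ.real {x | s < g x} := by
    rw [← probReal_compl_eq_one_sub (measurableSet_lt measurable_const hgm)]
    refine measureReal_congr ?_
    have hne : ∀ᵐ x ∂ρ, g x ≠ s := by simpa [ae_iff] using hs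
    filter_upwards [hne] with x hx
    refine propext ?_
    change g x < s ↔ ¬ s < g x
    rw [not_lt, hx.le_iff_lt]
  refine (ENNReal.tendsto_toReal_iff (by finiteness) (by finiteness)).1 ?_
  refine tendsto_order.2 ⟨fun r hr => hlower hr, fun r hr => ?_⟩
  have h1 : 1 - r < ρ.real {x | g x < s} := by
    rw [hcompl]
    exact sub_lt_sub_left hr 1
  filter_upwards [hupper h1] with n hn
  have hle : (τ n).real {x | f n x < s} ≤ 1 - (τ n).real {x | s < f n x} := by
    rw [← probReal_compl_eq_one_sub (measurableSet_lt measurable_const (hfm n))]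
    exact measureReal_mono fun x (hx : f n x < s) => not_lt.2 hx.le
  change (τ n).real {x | s < f n x} < r
  linarith

lemma lintegral_Ioi_ofReal_exp_neg_mul_ne_top {a : ℝ} (ha : 0 < a) :
    ∫⁻ s in Set.Ioi (0 : ℝ), ENNReal.ofReal (Real.exp (-a * s)) ≠ ∞ :=
  (integrableOn_exp_mul_Ioi (neg_lt_zero.2 ha) 0).lintegral_lt_top.ne

/-- Convergence of integrals from convergence of tail probabilities with an integrable bound. -/
lemma tendsto_integral_of_tendsto_measure_lt {Ω : Type*} [MeasurableSpace Ω]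
    {τ : ℕ → Measure Ω} {ρ : Measure Ω} {f : ℕ → Ω → ℝ} {g : Ω → ℝ}
    (hf : ∀ n, Measurable (f n)) (hf0 : ∀ n, 0 ≤ᵐ[τ n] f n)
    (hg : Measurable g) (hg0 : 0 ≤ᵐ[ρ] g) (bound : ℝ → ℝ≥0∞)
    (hbound : ∀ n s, τ n {x | s < f n x} ≤ bound s)
    (hfin : ∫⁻ s in Set.Ioi (0 : ℝ), bound s ≠ ∞)
    (hlim : ∀ᵐ s : ℝ, Tendsto (fun n => τ n {x | s < f n x}) atTop (𝓝 (ρ {x | s < g x}))) :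
    Tendsto (fun n => ∫ x, f n x ∂τ n) atTop (𝓝 (∫ x, g x ∂ρ)) := by
  have hanti {μ : Measure Ω} {k : Ω → ℝ} : Antitone fun s => μ {x | s < k x} :=
    fun s t hst => measure_mono fun x (hx : t < k x) => hst.trans_lt hx
  have hlim' := ae_restrict_of_ae (s := Set.Ioi 0) hlim
  have key := tendsto_lintegral_of_dominated_convergence (μ := volume.restrict (Set.Ioi (0 : ℝ)))
    bound (fun n => (hanti (μ := τ n) (k := f n)).measurable)
    (fun n => Eventually.of_forall (hbound n)) hfin hlim'
  have hne : ∫⁻ s in Set.Ioi (0 : ℝ), ρ {x | s < g x} ≠ ∞ := by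
    refine ne_top_of_le_ne_top hfin (lintegral_mono_ae ?_)
    filter_upwards [hlim'] with s hs
    exact le_of_tendsto hs (Eventually.of_forall fun n => hbound n s)
  simp_rw [integral_eq_lintegral_of_nonneg_ae (hf0 _) (hf _).aestronglyMeasurable,
    integral_eq_lintegral_of_nonneg_ae hg0 hg.aestronglyMeasurable,
    lintegral_eq_lintegral_meas_lt _ (hf0 _) (hf _).aemeasurable,
    lintegral_eq_lintegral_meas_lt _ hg0 hg.aemeasurable]
  exact (ENNReal.tendsto_toReal hne).comp key

lemma ae_measure_level_set_eq_zero {Ω : Type*} [MeasurableSpace Ω] {ρ : Measure Ω} [SFinite ρ]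
    {g : Ω → ℝ} (hg : Measurable g) : ∀ᵐ s : ℝ, ρ {x | g x = s} = 0 := by
  simpa [ae_iff, pos_iff_ne_zero] using
    (Measure.countable_meas_level_set_pos (μ := ρ) hg).measure_zero volume

/-- For `H, Q` max-stable with unit Fréchet marginals, `F ∈ MDA(H)`,
`G ∈ MDA(Q)` continuous dfs of probability measures on `[0,∞)^d` with tail-equivalent
marginals, and `σ_n` the measure with df `F^n`,
`lim_n n ∫ (1 - G(x)) dσ_n(x) = -∫ ln Q(x) dμ_H(x) = μ(Q,H)`. -/
theorem stmt4 {d : ℕ} (hd : 1 ≤ d)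
    (ρH ρQ ρF ρG : Measure (Fin d → ℝ))
    [IsProbabilityMeasure ρH] [IsProbabilityMeasure ρQ]
    [IsProbabilityMeasure ρF] [IsProbabilityMeasure ρG]
    (hHm : HasFrechetMarginals ρH) (hQm : HasFrechetMarginals ρQ)
    (hHms : MaxStable ρH) (hQms : MaxStable ρQ)
    (hFsupp : SupportedOnNonneg ρF) (hGsupp : SupportedOnNonneg ρG)
    (hFcont : Continuous (df ρF)) (hGcont : Continuous (df ρG))
    (hFmda : MDA ρF ρH) (hGmda : MDA ρG ρQ)
    (c : Fin d → ℝ) (hc : ∀ i, 0 < c i)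
    (htail : ∀ i, Tendsto (fun x : ℝ => (1 - marg ρF i x) / (1 - marg ρG i x))
      atTop (𝓝 (c i)))
    (σ : ℕ → Measure (Fin d → ℝ))
    (hσ : ∀ n : ℕ, 1 ≤ n → IsProbabilityMeasure (σ n) ∧
      ∀ x, df (σ n) x = (df ρF x) ^ n) :
    Tendsto (fun n : ℕ => (n : ℝ) * ∫ x, (1 - df ρG x) ∂(σ n)) atTop
      (𝓝 (-(∫ x, Real.log (df ρQ x) ∂ρH))) := by
  choose K hK hKle using fun i => exists_one_sub_marg_le (hc i) (htail i)
  have hQc := hQm.continuous_df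
  have hgm : Measurable fun x => -Real.log (df ρQ x) :=
    (Real.measurable_log.comp hQc.measurable).neg
  have hGm : Measurable (df ρG) := hGcont.measurable
  rw [← integral_neg, ← tendsto_add_atTop_iff_nat 1]
  simp_rw [← integral_const_mul]
  have hσp (n : ℕ) : IsProbabilityMeasure (σ (n + 1)) := (hσ (n + 1) n.succ_pos).1
  refine tendsto_integral_of_tendsto_measure_lt
    (bound := fun s => ∑ i, ENNReal.ofReal (Real.exp (-(d * K i)⁻¹ * s)))
    (fun n => (hGm.const_sub 1).const_mul _)
    (fun n => Eventually.of_forall fun x =>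
      mul_nonneg (Nat.cast_nonneg _) (sub_nonneg.2 (df_le_one ρG x)))
    hgm
    (Eventually.of_forall fun x =>
      neg_nonneg.2 (Real.log_nonpos (df_nonneg ρQ x) (df_le_one ρQ x)))
    (fun n s => measure_mul_one_sub_df_lt_le hd n.succ_pos (hσ (n + 1) n.succ_pos).2 hK hKle s)
    ?_ ?_
  · rw [lintegral_finsetSum _ fun i _ => by fun_prop]
    refine ENNReal.sum_ne_top.2 fun i _ => lintegral_Ioi_ofReal_exp_neg_mul_ne_top ?_
    have := hK i
    have hd0 : (0 : ℝ) < d := by exact_mod_cast hd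
    positivity
  have hscale (n : ℕ) : Measurable fun (x : Fin d → ℝ) i => ((n + 1 : ℕ) : ℝ)⁻¹ * x i := by
    fun_prop
  have hτp (n : ℕ) : IsProbabilityMeasure
      ((σ (n + 1)).map fun x i => ((n + 1 : ℕ) : ℝ)⁻¹ * x i) :=
    Measure.isProbabilityMeasure_map (hscale n).aemeasurable
  have hτdf (n : ℕ) (x : Fin d → ℝ) :
      df ((σ (n + 1)).map fun x i => ((n + 1 : ℕ) : ℝ)⁻¹ * x i) x =
        df ρF (fun i => ((n + 1 : ℕ) : ℝ) * x i) ^ (n + 1) := by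
    rw [← (hσ (n + 1) n.succ_pos).2, df_eq_real, df_eq_real,
      map_measureReal_apply (hscale n) measurableSet_Iic]
    congr 1
    ext y
    have hn : (0 : ℝ) < (n + 1 : ℕ) := by positivity
    simp only [Set.mem_preimage, Set.mem_Iic, Pi.le_def, inv_mul_le_iff₀ hn]
  have hfanti (n : ℕ) : Antitone fun x : Fin d → ℝ =>
      ((n + 1 : ℕ) : ℝ) * (1 - df ρG fun i => ((n + 1 : ℕ) : ℝ) * x i) := fun x y hxy =>
    mul_le_mul_of_nonneg_left (sub_le_sub_left (df_mono ρG fun i =>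
      mul_le_mul_of_nonneg_left (hxy i) (Nat.cast_nonneg _)) 1) (Nat.cast_nonneg _)
  have hfm (n : ℕ) : Measurable fun x : Fin d → ℝ =>
      ((n + 1 : ℕ) : ℝ) * (1 - df ρG fun i => ((n + 1 : ℕ) : ℝ) * x i) :=
    ((hGm.comp (by fun_prop)).const_sub 1).const_mul _
  filter_upwards [ae_measure_level_set_eq_zero (ρ := ρH) hgm] with s hs
  have key := tendsto_measure_lt_of_antitone
    (τ := fun n => (σ (n + 1)).map fun x i => ((n + 1 : ℕ) : ℝ)⁻¹ * x i)
    (fun x hx => by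
      simp_rw [hτdf]
      exact (tendsto_add_atTop_iff_nat 1).2 (hFmda x hx))
    hHm.measure_posOrthant hfanti hfm hgm
    (fun x hx => (hQc.continuousAt.log (hQms.df_pos hQm hx).ne').neg)
    (fun x hx => (tendsto_add_atTop_iff_nat 1).2 (tendsto_mul_one_sub_of_tendsto_pow
      (hQms.df_pos hQm hx) (fun _ => df_nonneg _ _) (hGmda x hx))) hs
  refine key.congr fun n => ?_
  rw [Measure.map_apply (hscale n) (measurableSet_lt measurable_const (hfm n))]
  have hn : ((n + 1 : ℕ) : ℝ) ≠ 0 := by positivity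
  simp only [Set.preimage_ofPred_eq, mul_inv_cancel_left₀ hn]
end

section
/- Let d ≥ 1, let Y = (Y₁,…,Y_d) be a random vector of nonnegative random variables with E[Y_i] = 1 for each i ≤ d, and let Z = (Z₁,…,Z_d) be a random vector independent of Y whose df Q has unit Fréchet marginals. Let H(x₁,…,x_d) = exp(−E[max_{1≤i≤d} Y_i/x_i]) for x ∈ (0,∞)^d, and let υ be an exponent measure of H, i.e. a Borel measure on [0,∞)^d ∖ {0} with υ{y : y_i > x_i for some i ≤ d} = E[max_{1≤i≤d} Y_i/x_i] for all (x₁,…,x_d) ∈ (0,∞)^d. Then ∫_{(0,∞)^d} Q(x₁,…,x_d) dυ(x) = E[min_{1≤i≤d} Y_i/Z_i]. -/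
open MeasureTheory Filter Topology ProbabilityTheory
open scoped ENNReal

/-- Two measures that agree, with finite values, on the complements of the lower boxes
`{y | y ≤ x}` with `x ∈ (0,∞)^d` agree on `(0,∞)^d`. -/
theorem restrict_posOrthant_eq {d : ℕ} (μ ν : Measure (Fin d → ℝ)) [Nonempty (Fin d)]
    (hfin : ∀ x : Fin d → ℝ, (∀ i, 0 < x i) → μ {y | ∃ i, x i < y i} ≠ ⊤)
    (heq : ∀ x : Fin d → ℝ, (∀ i, 0 < x i) →
      μ {y | ∃ i, x i < y i} = ν {y | ∃ i, x i < y i}) :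
    μ.restrict (posOrthant d) = ν.restrict (posOrthant d) := by
  have hmeas (x : Fin d → ℝ) : MeasurableSet {y : Fin d → ℝ | ∃ i, x i < y i} := by
    simp only [Set.ofPred_exists]
    exact MeasurableSet.iUnion fun i => measurableSet_lt measurable_const (measurable_pi_apply i)
  have key (ε : ℝ) (hε : 0 < ε) :
      μ.restrict {y | ∀ i, ε < y i} = ν.restrict {y | ∀ i, ε < y i} := by
    set U : Set (Fin d → ℝ) := {y | ∃ i, ε < y i}
    have hUm : MeasurableSet U := hmeas fun _ => ε
    have hUeq : μ U = ν U := heq (fun _ => ε) fun _ => hε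
    have hUfin : μ U ≠ ⊤ := hfin (fun _ => ε) fun _ => hε
    let φ : (Fin d → ℝ) → (Fin d → ℝ) := fun y i => max (y i) ε
    have hφ : Measurable φ :=
      measurable_pi_lambda _ fun i => (measurable_pi_apply i).max measurable_const
    have : IsFiniteMeasure (μ.restrict U) := ⟨by simpa using hUfin.lt_top⟩
    have hmap : (μ.restrict U).map φ = (ν.restrict U).map φ := by
      refine ext_of_generate_finite
        (Set.pi Set.univ '' Set.pi Set.univ fun _ : Fin d => Set.range (Set.Iic : ℝ → Set ℝ))
        ?_ (IsPiSystem.pi fun _ => by simpa using isPiSystem_image_Iic (Set.univ : Set ℝ)) ?_ ?_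
      · refine (generateFrom_eq_pi (fun _ => (borel_eq_generateFrom_Iic ℝ).symm.trans
          (BorelSpace.measurable_eq (α := ℝ)).symm) fun _ => ?_).symm
        refine ⟨fun n : ℕ => Set.Iic (n : ℝ), fun n => ⟨_, rfl⟩, ?_⟩
        exact Set.iUnion_eq_univ_iff.2 fun x => (exists_nat_ge x).imp fun _ h => h
      · rintro _ ⟨t, ht, rfl⟩
        choose x hx using fun i => ht i (Set.mem_univ i)
        obtain rfl : (fun i => Set.Iic (x i)) = t := funext hx
        have hm : MeasurableSet (Set.univ.pi fun i => Set.Iic (x i)) :=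
          MeasurableSet.univ_pi fun _ => measurableSet_Iic
        rw [Measure.map_apply hφ hm, Measure.map_apply hφ hm,
          Measure.restrict_apply (hφ hm), Measure.restrict_apply (hφ hm)]
        by_cases hxε : ∀ i, ε ≤ x i
        · have hset : φ ⁻¹' (Set.univ.pi fun i => Set.Iic (x i)) ∩ U
              = U \ {y | ∃ i, x i < y i} := by
            ext y
            simp only [φ, Set.mem_inter_iff, Set.mem_preimage, Set.mem_univ_pi, Set.mem_Iic,
              max_le_iff, hxε, and_true, Set.mem_sdiff, Set.mem_ofPred_eq, not_exists, not_lt]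
            exact and_comm
          have hsub : {y : Fin d → ℝ | ∃ i, x i < y i} ⊆ U :=
            fun y ⟨i, hi⟩ => ⟨i, (hxε i).trans_lt hi⟩
          have hpos (i) : 0 < x i := hε.trans_le (hxε i)
          rw [hset, measure_sdiff hsub (hmeas x).nullMeasurableSet (hfin x hpos),
            measure_sdiff hsub (hmeas x).nullMeasurableSet (heq x hpos ▸ hfin x hpos),
            hUeq, heq x hpos]
        · have hset : φ ⁻¹' (Set.univ.pi fun i => Set.Iic (x i)) = ∅ := by
            push Not at hxε
            obtain ⟨i, hi⟩ := hxε
            refine Set.eq_empty_of_forall_notMem fun y hy => ?_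
            exact absurd ((le_max_right _ _).trans (hy i (Set.mem_univ i))) hi.not_ge
          rw [hset, Set.empty_inter, measure_empty, measure_empty]
      · simp [Measure.map_apply hφ, hUeq]
    refine Measure.ext fun B hB => ?_
    have hVm : MeasurableSet {y : Fin d → ℝ | ∀ i, ε < y i} := by
      simp only [Set.ofPred_forall]
      exact MeasurableSet.iInter fun i =>
        measurableSet_lt measurable_const (measurable_pi_apply i)
    have hset : φ ⁻¹' (B ∩ {y | ∀ i, ε < y i}) ∩ U = B ∩ {y | ∀ i, ε < y i} := by
      ext y
      constructor
      · rintro ⟨⟨h1, h2⟩, -⟩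
        have hy (i) : ε < y i := by simpa [φ] using h2 i
        have hφy : φ y = y := funext fun i => max_eq_left (hy i).le
        exact ⟨hφy ▸ h1, hy⟩
      · rintro ⟨h1, h2⟩
        have hφy : φ y = y := funext fun i => max_eq_left (h2 i).le
        exact ⟨by simpa only [Set.mem_preimage, hφy] using ⟨h1, h2⟩, ‹Nonempty (Fin d)›.some, h2 _⟩
    have h := congrArg (fun ρ => ρ (B ∩ {y | ∀ i, ε < y i})) hmap
    simp only [Measure.map_apply hφ (hB.inter hVm)] at h
    rw [Measure.restrict_apply (hφ (hB.inter hVm)), Measure.restrict_apply (hφ (hB.inter hVm)),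
      hset] at h
    rwa [Measure.restrict_apply hB, Measure.restrict_apply hB]
  have hO : posOrthant d = ⋃ n : ℕ, {y | ∀ i, 1 / ((n : ℝ) + 1) < y i} := by
    ext y
    simp only [posOrthant, Set.mem_ofPred_eq, Set.mem_iUnion]
    constructor
    · intro hy
      obtain ⟨i, hi⟩ := Finite.exists_min y
      obtain ⟨n, hn⟩ := exists_nat_one_div_lt (hy i)
      exact ⟨n, fun j => hn.trans_le (hi j)⟩
    · rintro ⟨n, hn⟩ i
      exact Nat.one_div_pos_of_nat.trans (hn i)
  rw [hO, Measure.restrict_iUnion_congr]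
  exact fun n => key _ Nat.one_div_pos_of_nat

/-- The law of `y / s` under `ρ(dy) ds` on `s > 0`. If `ρ` is the law of `Y`, this is the
exponent measure of the max-stable law with de Haan representation `Y`. -/
noncomputable def radialMeasure {d : ℕ} (ρ : Measure (Fin d → ℝ)) : Measure (Fin d → ℝ) :=
  (ρ.prod (volume.restrict (Set.Ioi (0 : ℝ)))).map fun p i => p.1 i / p.2

theorem measurable_div_scalar {d : ℕ} :
    Measurable fun (p : (Fin d → ℝ) × ℝ) (i : Fin d) => p.1 i / p.2 :=
  measurable_pi_lambda _ fun i =>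
    ((measurable_pi_apply i).comp measurable_fst).div measurable_snd

theorem radialMeasure_exists_lt {d : ℕ} [Nonempty (Fin d)] (ρ : Measure (Fin d → ℝ))
    (x : Fin d → ℝ) (hx : ∀ i, 0 < x i) :
    radialMeasure ρ {y | ∃ i, x i < y i} = ∫⁻ y, ENNReal.ofReal (⨆ i, y i / x i) ∂ρ := by
  have hm : MeasurableSet {y : Fin d → ℝ | ∃ i, x i < y i} := by
    simp only [Set.ofPred_exists]
    exact MeasurableSet.iUnion fun i => measurableSet_lt measurable_const (measurable_pi_apply i)
  rw [radialMeasure, Measure.map_apply measurable_div_scalar hm,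
    Measure.prod_apply (measurable_div_scalar hm)]
  refine lintegral_congr fun y => ?_
  rw [Measure.restrict_apply' measurableSet_Ioi]
  have hset : Prod.mk y ⁻¹' ((fun (p : (Fin d → ℝ) × ℝ) i => p.1 i / p.2) ⁻¹'
      {y | ∃ i, x i < y i}) ∩ Set.Ioi 0 = Set.Ioo 0 (⨆ i, y i / x i) := by
    ext s
    simp only [Set.mem_inter_iff, Set.mem_preimage, Set.mem_ofPred_eq, Set.mem_Ioi, Set.mem_Ioo]
    rw [and_comm]
    refine and_congr_right fun hs => ?_
    rw [lt_ciSup_iff (Set.finite_range _).bddAbove]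
    exact exists_congr fun i => lt_div_comm₀ (hx i) hs
  rw [hset, Real.volume_Ioo, sub_zero]

theorem lintegral_radialMeasure_posOrthant {d : ℕ} [Nonempty (Fin d)]
    (ρ κ : Measure (Fin d → ℝ)) [SFinite ρ] [SFinite κ] (hκ : ∀ᵐ z ∂κ, ∀ i, 0 < z i) :
    ∫⁻ x in posOrthant d, κ (Set.Iic x) ∂(radialMeasure ρ) =
      ∫⁻ y, ∫⁻ z, ENNReal.ofReal (⨅ i, y i / z i) ∂κ ∂ρ := by
  have hO : MeasurableSet (posOrthant d) := by
    simp only [posOrthant, Set.ofPred_forall]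
    exact MeasurableSet.iInter fun i => measurableSet_lt measurable_const (measurable_pi_apply i)
  set W : Set ((Fin d → ℝ) × (Fin d → ℝ)) := {p | p.1 ∈ posOrthant d ∧ p.2 ≤ p.1} with hWdef
  have hW : MeasurableSet W :=
    (measurable_fst hO).inter (measurableSet_le measurable_snd measurable_fst)
  have hWint : ∫⁻ x in posOrthant d, κ (Set.Iic x) ∂(radialMeasure ρ) =
      ∫⁻ x, κ (Prod.mk x ⁻¹' W) ∂(radialMeasure ρ) := by
    rw [← lintegral_indicator hO]
    refine lintegral_congr fun x => ?_
    by_cases hx : x ∈ posOrthant d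
    · rw [Set.indicator_of_mem hx]
      congr 1
      ext z
      simp [hWdef, hx]
    · rw [Set.indicator_of_notMem hx]
      simp [hWdef, hx]
  have hf : Measurable fun x => κ (Prod.mk x ⁻¹' W) := measurable_measure_prodMk_left hW
  rw [hWint, radialMeasure, lintegral_map hf measurable_div_scalar,
    lintegral_prod
      (fun p : (Fin d → ℝ) × ℝ => κ (Prod.mk (fun i => p.1 i / p.2) ⁻¹' W))
      (hf.comp measurable_div_scalar).aemeasurable]
  refine lintegral_congr fun y => ?_
  have hg : Measurable fun p : ℝ × (Fin d → ℝ) => ((fun i => y i / p.1 : Fin d → ℝ), p.2) :=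
    (measurable_pi_lambda _ fun i => measurable_const.div measurable_fst).prodMk measurable_snd
  calc ∫⁻ s in Set.Ioi (0 : ℝ), κ (Prod.mk (fun i => y i / s) ⁻¹' W)
      = ((volume.restrict (Set.Ioi (0 : ℝ))).prod κ)
          ((fun p : ℝ × (Fin d → ℝ) => ((fun i => y i / p.1 : Fin d → ℝ), p.2)) ⁻¹' W) :=
        (Measure.prod_apply (hg hW)).symm
    _ = ∫⁻ z, ENNReal.ofReal (⨅ i, y i / z i) ∂κ := by
        rw [Measure.prod_apply_symm (hg hW)]
        refine lintegral_congr_ae ?_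
        filter_upwards [hκ] with z hz
        rw [Measure.restrict_apply' measurableSet_Ioi]
        have hset : (fun s : ℝ => (s, z)) ⁻¹'
            ((fun p : ℝ × (Fin d → ℝ) => ((fun i => y i / p.1 : Fin d → ℝ), p.2)) ⁻¹' W) ∩
            Set.Ioi 0 = Set.Ioc 0 (⨅ i, y i / z i) := by
          ext s
          simp only [hWdef, posOrthant, Set.mem_inter_iff, Set.mem_preimage, Set.mem_ofPred_eq,
            Set.mem_Ioi, Set.mem_Ioc, Pi.le_def]
          rw [and_comm]
          refine and_congr_right fun hs => ?_
          rw [le_ciInf_iff (Set.finite_range _).bddBelow,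
            and_iff_right_of_imp fun h i => (hz i).trans_le (h i)]
          exact forall_congr' fun i => le_div_comm₀ (hz i) hs
        rw [hset, Real.volume_Ioc, sub_zero]

/-- With `H(x) = exp(-E[max_i Y_i/x_i])` the de Haan representation and `υ`
an exponent measure of `H`, i.e. `υ{y : ∃ i, y_i > x_i} = E[max_i Y_i/x_i]` on `(0,∞)^d`,
and `Q` the df of `Z` (independent of `Y`, unit Fréchet marginals),
`∫_{(0,∞)^d} Q(x) dυ(x) = E[min_i Y_i/Z_i]`. -/
theorem stmt7 {d : ℕ} (hd : 1 ≤ d)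
    {Ω : Type*} [MeasurableSpace Ω] (P : Measure Ω) [IsProbabilityMeasure P]
    (Y Z : Ω → Fin d → ℝ) (hYmeas : Measurable Y) (hZmeas : Measurable Z)
    (hYnn : ∀ ω i, 0 ≤ Y ω i)
    (hYint : ∀ i, Integrable (fun ω => Y ω i) P)
    (hYmean : ∀ i, ∫ ω, Y ω i ∂P = 1)
    (hindep : IndepFun Y Z P)
    (hZfrechet : ∀ (i : Fin d) (t : ℝ), (P {ω | Z ω i ≤ t}).toReal = frechet t)
    (υ : Measure (Fin d → ℝ))
    (hexp : ∀ x : Fin d → ℝ, (∀ i, 0 < x i) →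
      (υ {y | ∃ i, x i < y i}).toReal = ∫ ω, ⨆ i, Y ω i / x i ∂P) :
    ∫ x in posOrthant d, (P {ω | ∀ i, Z ω i ≤ x i}).toReal ∂υ =
      ∫ ω, ⨅ i, Y ω i / Z ω i ∂P := by
  have : Nonempty (Fin d) := ⟨⟨0, hd⟩⟩
  have hYρ : IsProbabilityMeasure (P.map Y) := Measure.isProbabilityMeasure_map hYmeas.aemeasurable
  have hZκ : IsProbabilityMeasure (P.map Z) := Measure.isProbabilityMeasure_map hZmeas.aemeasurable
  have hZpos : ∀ᵐ ω ∂P, ∀ i, 0 < Z ω i := by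
    refine ae_all_iff.2 fun i => ?_
    have h := hZfrechet i 0
    rw [frechet, if_neg (lt_irrefl _), ENNReal.toReal_eq_zero_iff] at h
    simpa [ae_iff] using h.resolve_right (measure_ne_top _ _)
  have hZpos' : ∀ᵐ z ∂(P.map Z), ∀ i, 0 < z i := by
    refine (ae_map_iff hZmeas.aemeasurable ?_).2 hZpos
    simp only [Set.ofPred_forall]
    exact MeasurableSet.iInter fun i => measurableSet_lt measurable_const (measurable_pi_apply i)
  have hYcoord (i : Fin d) : Measurable fun ω => Y ω i := (measurable_pi_apply i).comp hYmeas
  have hsup (x : Fin d → ℝ) (hx : ∀ i, 0 < x i) :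
      υ {y | ∃ i, x i < y i} = radialMeasure (P.map Y) {y | ∃ i, x i < y i} ∧
        υ {y | ∃ i, x i < y i} ≠ ⊤ := by
    have hbdd (ω) : BddAbove (Set.range fun i => Y ω i / x i) := (Set.finite_range _).bddAbove
    have hnn (ω) : 0 ≤ ⨆ i, Y ω i / x i :=
      Real.iSup_nonneg fun i => div_nonneg (hYnn ω i) (hx i).le
    have hint : Integrable (fun ω => ⨆ i, Y ω i / x i) P := by
      refine (integrable_finsetSum Finset.univ fun i _ => (hYint i).div_const (x i)).mono'
        (Measurable.iSup fun i => (hYcoord i).div_const (x i)).aestronglyMeasurable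
        (Eventually.of_forall fun ω => ?_)
      rw [Real.norm_of_nonneg (hnn ω)]
      exact ciSup_le fun i => Finset.single_le_sum
        (f := fun i => Y ω i / x i) (fun j _ => div_nonneg (hYnn ω j) (hx j).le)
        (Finset.mem_univ i)
    have hpos : 0 < ∫ ω, ⨆ i, Y ω i / x i ∂P := by
      let i : Fin d := ⟨0, hd⟩
      calc 0 < 1 / x i := one_div_pos.2 (hx i)
        _ = ∫ ω, Y ω i / x i ∂P := by rw [integral_div, hYmean]
        _ ≤ _ := integral_mono ((hYint i).div_const _) hint fun ω => le_ciSup (hbdd ω) i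
    have hfin : υ {y | ∃ i, x i < y i} ≠ ⊤ := fun h => by
      simpa [h, hpos.ne] using hexp x hx
    refine ⟨?_, hfin⟩
    rw [radialMeasure_exists_lt _ x hx, lintegral_map
      (Measurable.iSup fun i => (measurable_pi_apply i).div_const (x i)).ennreal_ofReal hYmeas,
      ← ofReal_integral_eq_lintegral_ofReal hint (Eventually.of_forall hnn), ← hexp x hx,
      ENNReal.ofReal_toReal hfin]
  have hinf : Measurable fun p : (Fin d → ℝ) × (Fin d → ℝ) =>
      ENNReal.ofReal (⨅ i, p.1 i / p.2 i) :=
    (Measurable.iInf fun i => ((measurable_pi_apply i).comp measurable_fst).div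
      ((measurable_pi_apply i).comp measurable_snd)).ennreal_ofReal
  have hcdf_meas : Measurable fun x : Fin d → ℝ => P {ω | ∀ i, Z ω i ≤ x i} := by
    have hm : MeasurableSet {p : (Fin d → ℝ) × Ω | Z p.2 ≤ p.1} :=
      measurableSet_le (hZmeas.comp measurable_snd) measurable_fst
    exact measurable_measure_prodMk_left hm
  rw [integral_toReal hcdf_meas.aemeasurable (Eventually.of_forall fun _ => measure_lt_top _ _),
    integral_eq_lintegral_of_nonneg_ae,
    restrict_posOrthant_eq υ (radialMeasure (P.map Y)) (fun x hx => (hsup x hx).2)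
      (fun x hx => (hsup x hx).1)]
  · congr 1
    have hcdf (x : Fin d → ℝ) : P {ω | ∀ i, Z ω i ≤ x i} = P.map Z (Set.Iic x) := by
      rw [Measure.map_apply hZmeas measurableSet_Iic]
      rfl
    simp only [hcdf]
    rw [lintegral_radialMeasure_posOrthant _ _ hZpos', ← lintegral_prod _ hinf.aemeasurable,
      ← (indepFun_iff_map_prod_eq_prod_map_map hYmeas.aemeasurable hZmeas.aemeasurable).1 hindep,
      lintegral_map hinf (hYmeas.prodMk hZmeas)]
  · filter_upwards [hZpos] with ω hω
    exact Real.iInf_nonneg fun i => div_nonneg (hYnn ω i) (hω i).le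
  · exact (Measurable.iInf fun i => (hYcoord i).div
      ((measurable_pi_apply i).comp hZmeas)).aestronglyMeasurable
end

section
/- Let d ≥ 1, let Y = (Y₁,…,Y_d) be a random vector of nonnegative random variables with E[Y_i] = 1 for each i ≤ d, and let Z = (Z₁,…,Z_d) be a random vector independent of Y whose df has unit Fréchet marginals (so each Z_i > 0 almost surely and E[1/Z_i] = 1). Then E[max_{1≤i≤d} Y_i/Z_i] ≥ max( E[max_{1≤i≤d} Y_i], E[max_{1≤i≤d} 1/Z_i] ) ≥ 1. -/
open MeasureTheory Filter Topology ProbabilityTheory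
open scoped ENNReal

/-- If `B` is independent of `A` and its coordinates have mean one, then multiplying `A`
coordinatewise by `B` cannot decrease the expected maximum. -/
theorem lintegral_iSup_le_lintegral_iSup_mul {ι Ω : Type*} [Countable ι] [MeasurableSpace Ω]
    {P : Measure Ω} [IsProbabilityMeasure P] {A B : Ω → ι → ℝ≥0∞}
    (hA : Measurable A) (hB : Measurable B) (hAB : IndepFun A B P)
    (hmean : ∀ i, ∫⁻ ω, B ω i ∂P = 1) :
    ∫⁻ ω, ⨆ i, A ω i ∂P ≤ ∫⁻ ω, ⨆ i, A ω i * B ω i ∂P := by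
  have : IsProbabilityMeasure (P.map B) := Measure.isProbabilityMeasure_map hB.aemeasurable
  have hprod := (indepFun_iff_map_prod_eq_prod_map_map hA.aemeasurable hB.aemeasurable).1 hAB
  have hmeas : Measurable fun p : (ι → ℝ≥0∞) × (ι → ℝ≥0∞) => ⨆ i, p.1 i * p.2 i := by
    fun_prop
  calc ∫⁻ ω, ⨆ i, A ω i ∂P
      = ∫⁻ a, ⨆ i, a i ∂(P.map A) := (lintegral_map (by fun_prop) hA).symm
    _ ≤ ∫⁻ a, ∫⁻ b, ⨆ i, a i * b i ∂(P.map B) ∂(P.map A) := by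
        refine lintegral_mono fun a => iSup_le fun i => ?_
        calc a i = ∫⁻ b, a i * b i ∂(P.map B) := by
              rw [lintegral_const_mul _ (by fun_prop), lintegral_map (by fun_prop) hB, hmean,
                mul_one]
          _ ≤ _ := lintegral_mono fun b => le_iSup (fun i => a i * b i) i
    _ = ∫⁻ p, ⨆ i, p.1 i * p.2 i ∂((P.map A).prod (P.map B)) :=
        (lintegral_prod _ hmeas.aemeasurable).symm
    _ = ∫⁻ ω, ⨆ i, A ω i * B ω i ∂P := by
        rw [← hprod, lintegral_map hmeas (hA.prodMk hB)]

/-- The reciprocal of a unit Fréchet random variable has mean one. -/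
theorem lintegral_inv_eq_one_of_frechet {Ω : Type*} [MeasurableSpace Ω] {P : Measure Ω}
    [IsProbabilityMeasure P] {X : Ω → ℝ} (hX : Measurable X)
    (hF : ∀ t : ℝ, (P {ω | X ω ≤ t}).toReal = frechet t) :
    ∫⁻ ω, ENNReal.ofReal (X ω)⁻¹ ∂P = 1 := by
  have hpos : ∀ᵐ ω ∂P, 0 < X ω := by
    have h0 := hF 0
    simp only [frechet, lt_irrefl, if_false, ENNReal.toReal_eq_zero_iff, measure_ne_top,
      or_false] at h0
    simpa [ae_iff] using h0
  rw [lintegral_eq_lintegral_meas_le P (hpos.mono fun ω h => (inv_pos.2 h).le)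
    hX.inv.aemeasurable]
  have htail : ∀ t ∈ Set.Ioi (0 : ℝ),
      P {ω | t ≤ (X ω)⁻¹} = ENNReal.ofReal (Real.exp (-t)) := by
    intro t ht
    have ht' : 0 < t := ht
    have hset : P {ω | t ≤ (X ω)⁻¹} = P {ω | X ω ≤ t⁻¹} := by
      refine measure_congr (hpos.mono fun ω h => ?_)
      exact propext (le_inv_comm₀ ht' h)
    rw [hset, ← ENNReal.ofReal_toReal (measure_ne_top P _), hF, frechet,
      if_pos (inv_pos.2 ht'), one_div, inv_inv]
  rw [setLIntegral_congr_fun measurableSet_Ioi htail,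
    ← ofReal_integral_eq_lintegral_ofReal (integrableOn_exp_neg_Ioi 0)
      (ae_of_all _ fun t => (Real.exp_pos _).le), integral_exp_neg_Ioi_zero, ENNReal.ofReal_one]

theorem ofReal_ciSup_of_finite {ι : Type*} [Finite ι] [Nonempty ι] (f : ι → ℝ) :
    ENNReal.ofReal (⨆ i, f i) = ⨆ i, ENNReal.ofReal (f i) :=
  Monotone.map_ciSup_of_continuousAt ENNReal.continuous_ofReal.continuousAt
    ENNReal.ofReal_mono (Set.finite_range f).bddAbove

/-- For `Y` nonnegative with `E[Y_i] = 1` and `Z` independent of `Y` with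
unit Fréchet marginals,
`E[max_i Y_i/Z_i] ≥ max(E[max_i Y_i], E[max_i 1/Z_i]) ≥ 1`
(expectations of the nonnegative random variables taken in `[0,∞]`). -/
theorem stmt8 {d : ℕ} (hd : 1 ≤ d)
    {Ω : Type*} [MeasurableSpace Ω] (P : Measure Ω) [IsProbabilityMeasure P]
    (Y Z : Ω → Fin d → ℝ) (hYmeas : Measurable Y) (hZmeas : Measurable Z)
    (hYnn : ∀ ω i, 0 ≤ Y ω i)
    (hYint : ∀ i, Integrable (fun ω => Y ω i) P)
    (hYmean : ∀ i, ∫ ω, Y ω i ∂P = 1)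
    (hindep : IndepFun Y Z P)
    (hZfrechet : ∀ (i : Fin d) (t : ℝ), (P {ω | Z ω i ≤ t}).toReal = frechet t) :
    max (∫⁻ ω, ENNReal.ofReal (⨆ i, Y ω i) ∂P)
        (∫⁻ ω, ENNReal.ofReal (⨆ i, (Z ω i)⁻¹) ∂P) ≤
      ∫⁻ ω, ENNReal.ofReal (⨆ i, Y ω i / Z ω i) ∂P ∧
    1 ≤ max (∫⁻ ω, ENNReal.ofReal (⨆ i, Y ω i) ∂P)
        (∫⁻ ω, ENNReal.ofReal (⨆ i, (Z ω i)⁻¹) ∂P) := by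
  have : Nonempty (Fin d) := ⟨⟨0, hd⟩⟩
  have hA : Measurable fun ω i => ENNReal.ofReal (Y ω i) := by fun_prop
  have hB : Measurable fun ω i => ENNReal.ofReal (Z ω i)⁻¹ := by fun_prop
  have hAmean : ∀ i, ∫⁻ ω, ENNReal.ofReal (Y ω i) ∂P = 1 := fun i => by
    rw [← ofReal_integral_eq_lintegral_ofReal (hYint i) (ae_of_all _ fun ω => hYnn ω i),
      hYmean, ENNReal.ofReal_one]
  have hBmean : ∀ i, ∫⁻ ω, ENNReal.ofReal (Z ω i)⁻¹ ∂P = 1 := fun i =>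
    lintegral_inv_eq_one_of_frechet (by fun_prop) (hZfrechet i)
  have hAB : IndepFun (fun ω i => ENNReal.ofReal (Y ω i))
      (fun ω i => ENNReal.ofReal (Z ω i)⁻¹) P :=
    hindep.comp (φ := fun y i => ENNReal.ofReal (y i))
      (ψ := fun z i => ENNReal.ofReal (z i)⁻¹) (by fun_prop) (by fun_prop)
  simp only [ofReal_ciSup_of_finite, div_eq_mul_inv, ENNReal.ofReal_mul (hYnn _ _)]
  refine ⟨max_le (lintegral_iSup_le_lintegral_iSup_mul hA hB hAB hBmean) ?_,
    le_max_of_le_left ?_⟩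
  · simpa only [mul_comm] using lintegral_iSup_le_lintegral_iSup_mul hB hA hAB.symm hAmean
  · rw [← hAmean ⟨0, hd⟩]
    exact lintegral_mono fun ω => le_iSup (fun i => ENNReal.ofReal (Y ω i)) ⟨0, hd⟩
end

section
/- Let d ≥ 1, let Y = (Y₁,…,Y_d) be a random vector of nonnegative random variables with E[Y_i] = 1 for each i ≤ d, and let Z = (Z₁,…,Z_d) be a random vector independent of Y whose df has unit Fréchet marginals (so each Z_i > 0 almost surely and E[1/Z_i] = 1). Then E[min_{1≤i≤d} Y_i/Z_i] ≤ min( E[min_{1≤i≤d} Y_i], E[min_{1≤i≤d} 1/Z_i] ) ≤ 1. -/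
open MeasureTheory Filter Topology ProbabilityTheory
open scoped ENNReal

theorem ae_pos_of_cdf_eq_frechet {Ω : Type*} [MeasurableSpace Ω] {P : Measure Ω}
    [IsProbabilityMeasure P] {X : Ω → ℝ}
    (hX : ∀ t : ℝ, (P {ω | X ω ≤ t}).toReal = frechet t) : ∀ᵐ ω ∂P, 0 < X ω := by
  have h := hX 0
  simp only [frechet, lt_irrefl, if_false, ENNReal.toReal_eq_zero_iff, measure_ne_top,
    or_false] at h
  simpa [ae_iff] using h

theorem lintegral_inv_le_one_of_cdf_eq_frechet {Ω : Type*} [MeasurableSpace Ω] {P : Measure Ω}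
    [IsProbabilityMeasure P] {X : Ω → ℝ} (hXm : Measurable X)
    (hX : ∀ t : ℝ, (P {ω | X ω ≤ t}).toReal = frechet t) :
    ∫⁻ ω, ENNReal.ofReal (X ω)⁻¹ ∂P ≤ 1 := by
  have hpos := ae_pos_of_cdf_eq_frechet hX
  rw [lintegral_eq_lintegral_meas_le P (hpos.mono fun ω h => (inv_pos.2 h).le)
    hXm.inv.aemeasurable]
  calc ∫⁻ t in Set.Ioi (0 : ℝ), P {ω | t ≤ (X ω)⁻¹}
      ≤ ∫⁻ t in Set.Ioi (0 : ℝ), ENNReal.ofReal (Real.exp (-t)) := by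
        refine setLIntegral_mono' measurableSet_Ioi fun t (ht : 0 < t) => ?_
        have hsub : {ω | t ≤ (X ω)⁻¹} ⊆ {ω | X ω ≤ t⁻¹} := fun ω (hω : t ≤ (X ω)⁻¹) =>
          (le_inv_comm₀ ht (inv_pos.1 (ht.trans_le hω))).1 hω
        refine (measure_mono hsub).trans ?_
        rw [← ENNReal.ofReal_toReal (measure_ne_top P _), hX, frechet, if_pos (inv_pos.2 ht),
          one_div, inv_inv]
    _ = 1 := by
        rw [← ofReal_integral_eq_lintegral_ofReal (integrableOn_exp_neg_Ioi 0)
          (Eventually.of_forall fun t => (Real.exp_pos _).le), integral_exp_neg_Ioi_zero,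
          ENNReal.ofReal_one]

/-- Multiplying by an independent vector whose components have mean at most one does not increase
the expected minimum of a nonnegative vector. -/
theorem lintegral_iInf_mul_le_of_indepFun {ι Ω : Type*} [Finite ι] [Nonempty ι]
    [MeasurableSpace Ω] {P : Measure Ω} [IsProbabilityMeasure P] {U V : Ω → ι → ℝ}
    (hU : Measurable U) (hV : Measurable V) (hU0 : ∀ᵐ ω ∂P, ∀ i, 0 ≤ U ω i)
    (hV1 : ∀ i, ∫⁻ ω, ENNReal.ofReal (V ω i) ∂P ≤ 1) (hUV : IndepFun U V P) :
    ∫⁻ ω, ENNReal.ofReal (⨅ i, U ω i * V ω i) ∂P ≤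
      ∫⁻ ω, ENNReal.ofReal (⨅ i, U ω i) ∂P := by
  have hf : Measurable fun p : (ι → ℝ) × (ι → ℝ) => ENNReal.ofReal (⨅ i, p.1 i * p.2 i) :=
    (Measurable.iInf fun i => by fun_prop).ennreal_ofReal
  have hg : Measurable fun u : ι → ℝ => ENNReal.ofReal (⨅ i, u i) :=
    (Measurable.iInf fun i => by fun_prop).ennreal_ofReal
  have := Measure.isProbabilityMeasure_map (μ := P) hV.aemeasurable
  have := Measure.isProbabilityMeasure_map (μ := P) hU.aemeasurable
  rw [← lintegral_map hf (hU.prodMk hV), ← lintegral_map hg hU,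
    (indepFun_iff_map_prod_eq_prod_map_map hU.aemeasurable hV.aemeasurable).1 hUV,
    lintegral_prod _ hf.aemeasurable]
  have hU0' : ∀ᵐ u ∂P.map U, ∀ i, 0 ≤ u i := by
    rw [ae_map_iff hU.aemeasurable (by measurability)]
    exact hU0
  refine lintegral_mono_ae (hU0'.mono fun u hu => ?_)
  obtain ⟨i, hi⟩ := exists_eq_ciInf_of_finite (f := u)
  have hcomp : Measurable fun v : ι → ℝ => ENNReal.ofReal (v i) := by fun_prop
  calc ∫⁻ v, ENNReal.ofReal (⨅ j, u j * v j) ∂P.map V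
      ≤ ∫⁻ v, ENNReal.ofReal (u i) * ENNReal.ofReal (v i) ∂P.map V := by
        refine lintegral_mono fun v => ?_
        rw [← ENNReal.ofReal_mul (hu i)]
        exact ENNReal.ofReal_le_ofReal (ciInf_le (Set.finite_range _).bddBelow i)
    _ = ENNReal.ofReal (u i) * ∫⁻ ω, ENNReal.ofReal (V ω i) ∂P := by
        rw [lintegral_const_mul _ hcomp, lintegral_map hcomp hV]
    _ ≤ ENNReal.ofReal (⨅ j, u j) := by
        rw [← hi]
        exact mul_le_of_le_one_right' (hV1 i)

/-- For `Y` nonnegative with `E[Y_i] = 1` and `Z` independent of `Y` with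
unit Fréchet marginals,
`E[min_i Y_i/Z_i] ≤ min(E[min_i Y_i], E[min_i 1/Z_i]) ≤ 1`
(expectations of the nonnegative random variables taken in `[0,∞]`). -/
theorem stmt9 {d : ℕ} (hd : 1 ≤ d)
    {Ω : Type*} [MeasurableSpace Ω] (P : Measure Ω) [IsProbabilityMeasure P]
    (Y Z : Ω → Fin d → ℝ) (hYmeas : Measurable Y) (hZmeas : Measurable Z)
    (hYnn : ∀ ω i, 0 ≤ Y ω i)
    (hYint : ∀ i, Integrable (fun ω => Y ω i) P)
    (hYmean : ∀ i, ∫ ω, Y ω i ∂P = 1)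
    (hindep : IndepFun Y Z P)
    (hZfrechet : ∀ (i : Fin d) (t : ℝ), (P {ω | Z ω i ≤ t}).toReal = frechet t) :
    ∫⁻ ω, ENNReal.ofReal (⨅ i, Y ω i / Z ω i) ∂P ≤
      min (∫⁻ ω, ENNReal.ofReal (⨅ i, Y ω i) ∂P)
        (∫⁻ ω, ENNReal.ofReal (⨅ i, (Z ω i)⁻¹) ∂P) ∧
    min (∫⁻ ω, ENNReal.ofReal (⨅ i, Y ω i) ∂P)
        (∫⁻ ω, ENNReal.ofReal (⨅ i, (Z ω i)⁻¹) ∂P) ≤ 1 := by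
  have : Nonempty (Fin d) := ⟨⟨0, hd⟩⟩
  have hZcomp : ∀ i, Measurable fun ω => Z ω i := fun i => (measurable_pi_apply i).comp hZmeas
  have hZinv : Measurable fun ω i => (Z ω i)⁻¹ := measurable_pi_lambda _ fun i => (hZcomp i).inv
  have hYone : ∀ i, ∫⁻ ω, ENNReal.ofReal (Y ω i) ∂P ≤ 1 := fun i => by
    rw [← ofReal_integral_eq_lintegral_ofReal (hYint i) (Eventually.of_forall fun ω => hYnn ω i),
      hYmean i, ENNReal.ofReal_one]
  have hind : IndepFun Y (fun ω i => (Z ω i)⁻¹) P :=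
    have hinv : Measurable fun (z : Fin d → ℝ) i => (z i)⁻¹ := by fun_prop
    hindep.comp measurable_id hinv
  refine ⟨le_min ?_ ?_, (min_le_left _ _).trans ?_⟩
  · simp only [div_eq_mul_inv]
    exact lintegral_iInf_mul_le_of_indepFun hYmeas hZinv (Eventually.of_forall hYnn)
      (fun i => lintegral_inv_le_one_of_cdf_eq_frechet (hZcomp i) (hZfrechet i)) hind
  · simp only [div_eq_inv_mul]
    refine lintegral_iInf_mul_le_of_indepFun hZinv hYmeas (ae_all_iff.2 fun i => ?_) hYone hind.symm
    exact (ae_pos_of_cdf_eq_frechet (hZfrechet i)).mono fun ω h => (inv_pos.2 h).le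
  · exact (lintegral_mono fun ω => ENNReal.ofReal_le_ofReal
      (ciInf_le (Set.finite_range _).bddBelow ⟨0, hd⟩)).trans (hYone ⟨0, hd⟩)
end

section
/- Let d ≥ 1 and let H be a max-stable df with unit Fréchet marginals. Then for all (x₁,…,x_d) ∈ (0,∞)^d, ∏_{i=1}^d Φ(x_i) ≤ H(x₁,…,x_d) ≤ min_{1≤i≤d} Φ(x_i); i.e., H lies between the product df H₀ and the upper df H_∞. -/
open MeasureTheory Filter Topology ProbabilityTheory
open scoped ENNReal

lemma one_sub_frechet_le {x : ℝ} (hx : 0 < x) : 1 - frechet x ≤ x⁻¹ := by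
  rw [frechet, if_pos hx, one_div]
  linarith [Real.add_one_le_exp (-x⁻¹)]

lemma prod_frechet {d : ℕ} {x : Fin d → ℝ} (hx : ∀ i, 0 < x i) :
    ∏ i, frechet (x i) = Real.exp (-∑ i, (x i)⁻¹) := by
  rw [← Finset.sum_neg_distrib, Real.exp_sum]
  exact Finset.prod_congr rfl fun i _ => by rw [frechet, if_pos (hx i), one_div]

lemma df_le_marg {d : ℕ} (ρ : Measure (Fin d → ℝ)) [IsFiniteMeasure ρ] (x : Fin d → ℝ)
    (i : Fin d) : df ρ x ≤ marg ρ i (x i) :=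
  measureReal_mono fun _ hy => hy i

/-- The lower Fréchet–Hoeffding bound. -/
lemma one_sub_sum_one_sub_marg_le_df {d : ℕ} (ρ : Measure (Fin d → ℝ)) [IsProbabilityMeasure ρ]
    (x : Fin d → ℝ) : 1 - ∑ i, (1 - marg ρ i (x i)) ≤ df ρ x := by
  have hmeas (i : Fin d) : MeasurableSet {y : Fin d → ℝ | y i ≤ x i} :=
    measurableSet_le (measurable_pi_apply i) measurable_const
  have hall : MeasurableSet {y : Fin d → ℝ | ∀ i, y i ≤ x i} := by
    rw [Set.ofPred_forall]
    exact MeasurableSet.iInter hmeas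
  have hdf : 1 - df ρ x = ρ.real (⋃ i, {y | y i ≤ x i}ᶜ) := by
    rw [← Set.compl_iInter, ← Set.ofPred_forall, probReal_compl_eq_one_sub hall]
    rfl
  have hmarg (i : Fin d) : ρ.real {y | y i ≤ x i}ᶜ = 1 - marg ρ i (x i) :=
    probReal_compl_eq_one_sub (hmeas i)
  have hle := measureReal_iUnion_fintype_le (μ := ρ) fun i => {y : Fin d → ℝ | y i ≤ x i}ᶜ
  simp only [hmarg] at hle
  linarith

lemma MaxStable.df_natCast_mul_pow {d : ℕ} {ρ : Measure (Fin d → ℝ)} (h : MaxStable ρ)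
    {n : ℕ} (hn : n ≠ 0) {x : Fin d → ℝ} (hx : ∀ i, 0 < x i) :
    df ρ (fun i => n * x i) ^ n = df ρ x := by
  rw [h n (by positivity) x hx, one_div]
  exact Real.rpow_inv_natCast_pow ENNReal.toReal_nonneg hn

/-- Any max-stable df `H` with unit Fréchet marginals satisfies
`∏_i Φ(x_i) ≤ H(x) ≤ min_i Φ(x_i)` for all `x ∈ (0,∞)^d`. -/
theorem stmt11 {d : ℕ} (hd : 1 ≤ d)
    (ρH : Measure (Fin d → ℝ)) [IsProbabilityMeasure ρH]
    (hHm : HasFrechetMarginals ρH) (hHms : MaxStable ρH) :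
    ∀ x : Fin d → ℝ, (∀ i, 0 < x i) →
      (∏ i, frechet (x i)) ≤ df ρH x ∧ df ρH x ≤ ⨅ i, frechet (x i) := by
  intro x hx
  constructor
  · rw [prod_frechet hx]
    set S := ∑ i, (x i)⁻¹ with hS
    refine le_of_tendsto (Real.tendsto_one_add_div_pow_exp (-S)) ?_
    filter_upwards [eventually_gt_atTop 0, eventually_ge_atTop ⌈S⌉₊] with n hn hnS
    have hn0 : (0 : ℝ) < n := Nat.cast_pos.2 hn
    rw [← hHms.df_natCast_mul_pow hn.ne' hx]
    refine pow_le_pow_left₀ ?_ ?_ n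
    · have : S / n ≤ 1 := (div_le_one hn0).2 (Nat.ceil_le.1 hnS)
      rw [neg_div]
      linarith
    · have hsum : ∑ i, (1 - marg ρH i (n * x i)) ≤ S / n := by
        rw [hS, Finset.sum_div]
        refine Finset.sum_le_sum fun i _ => ?_
        rw [hHm i]
        refine (one_sub_frechet_le (mul_pos hn0 (hx i))).trans_eq ?_
        rw [mul_inv, mul_comm, div_eq_mul_inv]
      have := one_sub_sum_one_sub_marg_le_df ρH fun i => n * x i
      rw [neg_div]
      linarith
  · have : Nonempty (Fin d) := ⟨⟨0, hd⟩⟩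
    exact le_ciInf fun i => (df_le_marg ρH x i).trans_eq (hHm i (x i))
end
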